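/- Assume the Generalised Riemann Hypothesis: for every positive integer q and every Dirichlet character χ modulo q, every zero s of the Dirichlet L-function L(s,χ) with 0 < Re(s) < 1 satisfies Re(s) = 1/2. Let f ∈ ℤ[X] be of degree d ≥ 2 belonging to class 𝒫₃, i.e. its derivative has the form f'(X) = g(X)²(aX+b) with g ∈ ℤ[X], a,b ∈ ℤ, a ≠ 0, and 0 is pre-periodic under f; set γ = -b/a. Assume γ is not a pre-periodic point of f. Then there exist a constant C > 0 and Q₀ (both depending only on f) such that for all Q ≥ Q₀ one has P_f(Q) ≤ C · Q / (log Q)². -/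

import Mathlib

open Polynomial

/-- The `n`-th iterate of a polynomial: `f^(0) = X`, `f^(n) = f(f^(n-1))`. -/
noncomputable def polyIter {R : Type*} [CommSemiring R] (f : R[X]) : ℕ → R[X]
  | 0 => X
  | n + 1 => f.comp (polyIter f n)

/-- A polynomial is dynamically irreducible if all its iterates `f^(n)`, `n ≥ 1`,
are irreducible. -/
def DynIrred {R : Type*} [CommSemiring R] (f : R[X]) : Prop :=
  ∀ n : ℕ, 1 ≤ n → Irreducible (polyIter f n)

/-- `γ ∈ ℚ` is pre-periodic for `f ∈ ℤ[X]` if its forward orbit `{f^(n)(γ) : n ≥ 1}`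
is finite. -/
def IsPreperiodicPt (f : ℤ[X]) (γ : ℚ) : Prop :=
  {x : ℚ | ∃ n : ℕ, 1 ≤ n ∧ x = Polynomial.aeval γ (polyIter f n)}.Finite

/-- `P_f(Q)`: the number of primes `p ∈ [Q, 2Q]` such that the reduction of `f` mod `p`
is dynamically irreducible over `𝔽_p`. -/
noncomputable def Pf (f : ℤ[X]) (Q : ℕ) : ℕ :=
  {p : ℕ | p.Prime ∧ Q ≤ p ∧ p ≤ 2 * Q ∧
    DynIrred (f.map (Int.castRingHom (ZMod p)))}.ncard

section Iterates

variable {R : Type*} [CommSemiring R] (f : R[X])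

theorem polyIter_zero : polyIter f 0 = X := rfl

theorem polyIter_succ (n : ℕ) : polyIter f (n + 1) = f.comp (polyIter f n) := rfl

theorem polyIter_one : polyIter f 1 = f := comp_X

theorem polyIter_add (m n : ℕ) : polyIter f (m + n) = (polyIter f m).comp (polyIter f n) := by
  induction m with
  | zero => rw [zero_add, polyIter_zero, X_comp]
  | succ m ih => rw [add_right_comm, polyIter_succ, ih, polyIter_succ, comp_assoc]

theorem map_polyIter {S : Type*} [CommSemiring S] (φ : R →+* S) (n : ℕ) :
    (polyIter f n).map φ = polyIter (f.map φ) n := by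
  induction n with
  | zero => simp [polyIter_zero]
  | succ n ih => rw [polyIter_succ, map_comp, ih, polyIter_succ]

theorem eval_polyIter_succ (n : ℕ) (x : R) :
    (polyIter f (n + 1)).eval x = f.eval ((polyIter f n).eval x) := by
  rw [polyIter_succ, eval_comp]

theorem eval_polyIter_add (m n : ℕ) (x : R) :
    (polyIter f (m + n)).eval x = (polyIter f m).eval ((polyIter f n).eval x) := by
  rw [polyIter_add, eval_comp]

theorem natDegree_polyIter [NoZeroDivisors R] [Nontrivial R] (n : ℕ) :
    (polyIter f n).natDegree = f.natDegree ^ n := by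
  induction n with
  | zero => simp [polyIter_zero]
  | succ n ih => rw [polyIter_succ, natDegree_comp, ih, pow_succ, mul_comm]

theorem leadingCoeff_polyIter_succ [NoZeroDivisors R] [Nontrivial R] (hf : f.natDegree ≠ 0)
    (n : ℕ) : (polyIter f (n + 1)).leadingCoeff =
      f.leadingCoeff * (polyIter f n).leadingCoeff ^ f.natDegree := by
  rw [polyIter_succ, leadingCoeff_comp]
  rw [natDegree_polyIter]
  exact pow_ne_zero _ hf

theorem derivative_polyIter (n : ℕ) :
    derivative (polyIter f n) = ∏ j ∈ Finset.range n, (derivative f).comp (polyIter f j) := by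
  induction n with
  | zero => simp [polyIter_zero]
  | succ n ih => rw [polyIter_succ, derivative_comp, ih, Finset.prod_range_succ]

end Iterates

section Stickelberger

theorem pow_finRotate {G : Type*} [Group G] {g : G} {D : ℕ} (hg : g ^ D = 1) (i : Fin D) :
    g ^ ((finRotate D i : Fin D) : ℕ) = g * g ^ (i : ℕ) := by
  obtain _ | m := D
  · exact i.elim0
  rw [← pow_succ']
  by_cases hi : i = Fin.last m
  · rw [hi, finRotate_last, Fin.val_zero, Fin.val_last, pow_zero, hg]
  · rw [coe_finRotate_of_ne_last hi]

variable {F L : Type*} [Field F] [Finite F] [Field L] [Algebra F L] [FiniteDimensional F L]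

theorem PowerBasis.not_isSquare_discr_of_even (hF : ringChar F ≠ 2)
    (pb : PowerBasis F L) (hpb : Even pb.dim) : ¬ IsSquare (Algebra.discr F pb.basis) := by
  classical
  have : Fintype F := Fintype.ofFinite F
  have : Finite L := Module.finite_of_finite F
  have hdim : Module.finrank F L = pb.dim := pb.finrank
  have hpos : 0 < pb.dim := hdim ▸ Module.finrank_pos
  let E := AlgebraicClosure L
  let φ := FiniteField.frobeniusAlgEquivOfAlgebraic F L
  have hφ1 : φ ^ pb.dim = 1 := by
    rw [← orderOf_dvd_iff_pow_eq_one, FiniteField.orderOf_frobeniusAlgEquivOfAlgebraic, hdim]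
  let e : Fin pb.dim ≃ (L →ₐ[F] E) :=
    (finCongr hdim.symm).trans
      ((Equiv.ofBijective _ (FiniteField.bijective_frobeniusAlgEquivOfAlgebraic_pow F L)).trans
        (Normal.algHomEquivAut F E L).symm)
  have he : ∀ i x, e i x = algebraMap L E ((φ ^ (i : ℕ)) x) := fun i x => rfl
  set M := Algebra.embeddingsMatrixReindex F E pb.basis e with hM
  have hdisc : algebraMap F E (Algebra.discr F pb.basis) = M.det ^ 2 :=
    Algebra.discr_eq_det_embeddingsMatrixReindex_pow_two F E pb.basis e
  let Φ : E →ₐ[F] E := FiniteField.frobeniusAlgHom F E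
  have hΦ : ∀ x, Φ x = x ^ Fintype.card F := fun x => rfl
  have hrot : ∀ i : Fin pb.dim, φ ^ ((finRotate pb.dim i : Fin pb.dim) : ℕ) = φ * φ ^ (i : ℕ) := pow_finRotate hφ1
  have hperm : M.map Φ = M.submatrix id (finRotate pb.dim) := by
    ext i j
    change Φ (e j (pb.basis i)) = e (finRotate _ j) (pb.basis i)
    rw [he, he, hrot, hΦ, ← map_pow]
    rfl
  have hdet : Φ M.det = - M.det := by
    have h1 : Φ M.det = (M.map Φ).det := by
      rw [← AlgHom.coe_toRingHom, RingHom.map_det]; rfl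
    rw [h1, hperm, Matrix.det_permute', sign_finRotate]
    have : Odd (pb.dim - 1) := Nat.Even.sub_odd hpos hpb odd_one
    rw [this.neg_one_pow]
    push_cast
    exact neg_one_mul M.det
  have h0 : M.det ≠ 0 := by
    intro h
    rw [h, zero_pow two_ne_zero, map_eq_zero] at hdisc
    exact Algebra.discr_not_zero_of_basis F pb.basis hdisc
  rintro ⟨x, hx⟩
  have hx2 : M.det = algebraMap F E x ∨ M.det = - algebraMap F E x := by
    rw [← sq_eq_sq_iff_eq_or_eq_neg, ← hdisc, hx, map_mul, sq]
  have hfix : Φ M.det = M.det := by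
    rcases hx2 with h | h <;> rw [h] <;> simp
  rw [hfix, eq_neg_iff_add_eq_zero, ← two_mul, mul_eq_zero] at hdet
  rcases hdet with h | h
  · refine Ring.two_ne_zero (R := F) hF ?_
    rw [← map_eq_zero (algebraMap F E), map_ofNat]
    exact h
  · exact h0 h

theorem PowerBasis.norm_algebraMap_sub_gen (pb : PowerBasis F L) (c : F) :
    Algebra.norm F (algebraMap F L c - pb.gen) = (minpoly F pb.gen).eval c := by
  rw [← charpoly_leftMulMatrix pb, Algebra.leftMulMatrix_apply, LinearMap.charpoly_toMatrix,
    LinearMap.eval_charpoly, Algebra.norm_apply]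
  congr 1
  ext x
  simp [Algebra.smul_def]

omit [Finite F] in
theorem isSquare_norm_of_aeval_irreducible {y : L} {h : F[X]} (hh : Irreducible h)
    (hy : aeval y h = 0) {m : ℕ} (hm : Even m) (hL : Module.finrank F L = m * h.natDegree)
    {z : L} (hz : z ∈ IntermediateField.adjoin F {y}) : IsSquare (Algebra.norm F z) := by
  have hint : IsIntegral F y := Algebra.IsIntegral.isIntegral y
  have hdeg : Module.finrank F (IntermediateField.adjoin F {y}) = h.natDegree := by
    rw [IntermediateField.adjoin.finrank hint, ← minpoly.eq_of_irreducible hh hy,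
      natDegree_mul_C]
    exact inv_ne_zero (leadingCoeff_ne_zero.2 hh.ne_zero)
  have hmul := Module.finrank_mul_finrank F (IntermediateField.adjoin F {y}) L
  rw [hdeg, hL, mul_comm, Nat.mul_left_inj hh.natDegree_pos.ne'] at hmul
  rw [← Algebra.norm_norm (S := IntermediateField.adjoin F {y}),
    show z = algebraMap (IntermediateField.adjoin F {y}) L ⟨z, hz⟩ from rfl,
    Algebra.norm_algebraMap, hmul, map_pow]
  exact hm.isSquare_pow _

omit [FiniteDimensional F L] [Algebra F L] [Field L] in
theorem not_isSquare_leadingCoeff_mul_eval_polyIter (hF : ringChar F ≠ 2) {f g : F[X]} {a b : F}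
    (ha : a ≠ 0) (hfg : derivative f = g ^ 2 * (C a * X + C b)) (hd : Even f.natDegree)
    (hirr : DynIrred f) {n : ℕ} (hn : 2 ≤ n) :
    ¬ IsSquare (f.leadingCoeff * (polyIter f n).eval (-b / a)) := by
  intro hsq
  have hf1 : Irreducible f := by simpa [polyIter_one] using hirr 1 le_rfl
  have hf0 : f.natDegree ≠ 0 := hf1.natDegree_pos.ne'
  set H := polyIter f n with hH
  have hHirr : Irreducible H := hirr n (by omega)
  have hH0 := hHirr.ne_zero
  have : Fact (Irreducible H) := ⟨hHirr⟩
  set pb := AdjoinRoot.powerBasis hH0 with hpb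
  have : FiniteDimensional F (AdjoinRoot H) := pb.finite
  have hmin : minpoly F pb.gen = H * C H.leadingCoeff⁻¹ := AdjoinRoot.minpoly_powerBasis_gen hH0
  set θ := pb.gen with hθ
  have hθH : aeval θ H = 0 := by
    rw [hθ, hpb, AdjoinRoot.powerBasis_gen]; simp
  have hdim : pb.dim = f.natDegree ^ n := by
    rw [hpb, AdjoinRoot.powerBasis_dim, hH, natDegree_polyIter]
  have hDeven : Even (f.natDegree ^ n) := hd.pow_of_ne_zero (by omega)
  have hfin : Module.finrank F (AdjoinRoot H) = f.natDegree ^ n := by rw [pb.finrank, hdim]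
  have hlc0 : f.leadingCoeff ≠ 0 := leadingCoeff_ne_zero.2 hf1.ne_zero
  have hHlc0 : H.leadingCoeff ≠ 0 := leadingCoeff_ne_zero.2 hH0
  have hlc : IsSquare (f.leadingCoeff * H.leadingCoeff) := by
    obtain ⟨m, rfl⟩ : ∃ m, n = m + 1 := ⟨n - 1, by omega⟩
    rw [hH, leadingCoeff_polyIter_succ f hf0, ← mul_assoc]
    exact (IsSquare.mul_self _).mul (hd.isSquare_pow _)
  have hquot : IsSquare (H.eval (-b / a) * H.leadingCoeff⁻¹) := by
    have : H.eval (-b / a) * H.leadingCoeff⁻¹ =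
        (f.leadingCoeff * H.eval (-b / a)) / (f.leadingCoeff * H.leadingCoeff) := by
      field_simp
    rw [this]
    exact hsq.div hlc
  have hlin : IsSquare (Algebra.norm F (algebraMap F _ a * θ + algebraMap F _ b)) := by
    have h1 : algebraMap F (AdjoinRoot H) a * θ + algebraMap F _ b =
        algebraMap F _ (-a) * (algebraMap F _ (-b / a) - θ) := by
      rw [mul_sub, ← map_mul]
      have : -a * (-b / a) = b := by field_simp
      rw [this, map_neg]; ring
    rw [h1, map_mul, Algebra.norm_algebraMap, hfin, PowerBasis.norm_algebraMap_sub_gen, hmin,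
      eval_mul, eval_C]
    exact (hDeven.isSquare_pow _).mul hquot
  have hroot : ∀ j ≤ n, aeval (aeval θ (polyIter f j)) (polyIter f (n - j)) = 0 := by
    intro j hj
    rw [← aeval_comp, ← polyIter_add, Nat.sub_add_cancel hj, hθH]
  have hder : IsSquare (Algebra.norm F (aeval θ (derivative H))) := by
    rw [show derivative H = _ from derivative_polyIter f n, map_prod, map_prod]
    refine Finset.prod_induction _ IsSquare (fun _ _ => IsSquare.mul) IsSquare.one fun j hj => ?_
    rw [Finset.mem_range] at hj
    rw [aeval_comp, hfg, map_mul, map_mul, map_pow, map_pow]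
    refine (IsSquare.sq _).mul ?_
    simp only [map_add, map_mul, aeval_C, aeval_X]
    obtain rfl | hj0 := Nat.eq_zero_or_pos j
    · simpa only [polyIter_zero, aeval_X] using hlin
    · refine isSquare_norm_of_aeval_irreducible (hirr (n - j) (by omega)) (hroot j hj.le)
        (hd.pow_of_ne_zero hj0.ne') ?_ ?_
      · rw [hfin, natDegree_polyIter, ← pow_add, Nat.add_sub_cancel' hj.le]
      · exact add_mem (mul_mem (algebraMap_mem _ _)
          (IntermediateField.mem_adjoin_simple_self F _)) (algebraMap_mem _ _)
  refine PowerBasis.not_isSquare_discr_of_even hF pb (hdim ▸ hDeven) ?_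
  rw [Algebra.discr_powerBasis_eq_norm, hmin, derivative_mul, derivative_C, mul_zero, add_zero,
    map_mul, map_mul, aeval_C, Algebra.norm_algebraMap, hfin]
  refine IsSquare.mul ?_ (hder.mul (hDeven.isSquare_pow _))
  refine Even.isSquare_pow ?_ _
  obtain ⟨m, rfl⟩ : ∃ m, n = m + 2 := ⟨n - 2, by omega⟩
  obtain ⟨c, hc⟩ := hd
  have : f.natDegree ^ (m + 2) * (f.natDegree ^ (m + 2) - 1) / 2 =
      2 * (c ^ 2 * f.natDegree ^ m * (f.natDegree ^ (m + 2) - 1)) := by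
    conv_lhs => rw [pow_add f.natDegree m 2]
    apply Nat.div_eq_of_eq_mul_left two_pos
    rw [← pow_add, pow_add, hc]; ring
  rw [this]
  exact even_two_mul _

end Stickelberger

section Runge

open Filter

theorem AbsoluteValue.eval_le_sum (v : AbsoluteValue ℚ ℝ) (p : ℚ[X]) (x : ℚ) {B : ℝ} (hx : v x ≤ B) :
    v (p.eval x) ≤ ∑ i ∈ Finset.range (p.natDegree + 1), v (p.coeff i) * B ^ i := by
  rw [eval_eq_sum_range]
  refine (v.sum_le _ _).trans (Finset.sum_le_sum fun i _ => ?_)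
  rw [map_mul, map_pow]
  gcongr

theorem AbsoluteValue.eventually_eval_le (v : AbsoluteValue ℚ ℝ) {p : ℚ[X]} {m : ℕ}
    (hp : p.degree < m) {ε : ℝ} (hε : 0 < ε) :
    ∀ᶠ x in comap v atTop, v (p.eval x) ≤ ε * v x ^ m := by
  obtain rfl | hp0 := eq_or_ne p 0
  · exact Eventually.of_forall fun x => by simp only [eval_zero, map_zero]; positivity
  have hlt : p.natDegree < m := (natDegree_lt_iff_degree_lt hp0).2 hp
  set S := ∑ i ∈ Finset.range (p.natDegree + 1), v (p.coeff i) with hS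
  have hbase : ∀ᶠ x in comap v atTop, max 1 (S / ε) ≤ v x :=
    tendsto_comap.eventually_ge_atTop _
  filter_upwards [hbase] with x hx
  have h1 : 1 ≤ v x := (le_max_left _ _).trans hx
  have h2 : S ≤ ε * v x := by
    have := (le_max_right _ _).trans hx
    rwa [div_le_iff₀' hε] at this
  obtain ⟨k, rfl⟩ : ∃ k, m = k + 1 := ⟨m - 1, by omega⟩
  calc v (p.eval x) ≤ ∑ i ∈ Finset.range (p.natDegree + 1), v (p.coeff i) * v x ^ i :=
        v.eval_le_sum p x le_rfl
    _ ≤ ∑ i ∈ Finset.range (p.natDegree + 1), v (p.coeff i) * v x ^ k := by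
        refine Finset.sum_le_sum fun i hi => ?_
        have : i ≤ k := by rw [Finset.mem_range] at hi; omega
        gcongr
    _ = S * v x ^ k := by rw [hS, Finset.sum_mul]
    _ ≤ (ε * v x) * v x ^ k := by gcongr
    _ = ε * v x ^ (k + 1) := by ring

theorem AbsoluteValue.eventually_eval_eq (v : AbsoluteValue ℚ ℝ) {p : ℚ[X]} {m : ℕ} {c : ℚ}
    (hm : p.natDegree = m) (hc : p.leadingCoeff = c) (hc0 : c ≠ 0) {ε : ℝ} (hε : 0 < ε) :
    ∀ᶠ x in comap v atTop, ∃ e, v e ≤ ε ∧ p.eval x = c * x ^ m * (1 + e) := by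
  have hp0 : p ≠ 0 := by rintro rfl; exact hc0 (by simpa using hc.symm)
  have hdeg : p.eraseLead.degree < m := by
    rw [← hm, ← degree_eq_natDegree hp0]
    exact degree_eraseLead_lt hp0
  have hvc : 0 < v c := v.pos hc0
  have hbase : ∀ᶠ x in comap v atTop, 1 ≤ v x := tendsto_comap.eventually_ge_atTop _
  filter_upwards [v.eventually_eval_le hdeg (mul_pos hε hvc), hbase] with x hx h1
  have hx0 : x ≠ 0 := by rintro rfl; rw [map_zero] at h1; linarith
  have hne : c * x ^ m ≠ 0 := by positivity
  refine ⟨p.eraseLead.eval x / (c * x ^ m), ?_, ?_⟩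
  · rw [map_div₀, div_le_iff₀ (v.pos hne), map_mul, map_pow, ← mul_assoc]
    exact hx
  · rw [mul_add, mul_one, mul_div_cancel₀ _ hne]
    conv_lhs => rw [← p.eraseLead_add_C_mul_X_pow]
    rw [eval_add, eval_mul, eval_C, eval_pow, eval_X, hm, hc, add_comm]

theorem Polynomial.exists_eq_sq_add {F : ℚ[X]} {m : ℕ} {c : ℚ} (hF : F.natDegree = 2 * m)
    (hc : F.leadingCoeff = c ^ 2) (hc0 : c ≠ 0) :
    ∃ P R : ℚ[X], F = P ^ 2 + R ∧ P.natDegree = m ∧ P.leadingCoeff = c ∧ R.degree < m := by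
  have key : ∀ r ≤ m, ∃ P : ℚ[X], P.natDegree = m ∧ P.leadingCoeff = c ∧
      (F - P ^ 2).degree < ((2 * m - r : ℕ) : WithBot ℕ) := by
    intro r
    induction r with
    | zero =>
      intro _
      have hF0 : F ≠ 0 := by
        rintro rfl
        rw [leadingCoeff_zero] at hc
        exact pow_ne_zero 2 hc0 hc.symm
      have hle : F.degree = (C c * X ^ m : ℚ[X]).degree + (C c * X ^ m : ℚ[X]).degree := by
        rw [degree_C_mul_X_pow _ hc0, degree_eq_natDegree hF0, hF, two_mul]; rfl
      refine ⟨C c * X ^ m, natDegree_C_mul_X_pow _ _ hc0, leadingCoeff_C_mul_X_pow _ _, ?_⟩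
      rw [Nat.sub_zero, ← hF, ← degree_eq_natDegree hF0]
      refine degree_sub_lt_left ?_ hF0 ?_
      · rw [sq, degree_mul, hle]
      · rw [leadingCoeff_pow, leadingCoeff_C_mul_X_pow, hc]
    | succ r ih =>
      intro hr
      obtain ⟨P, hP, hPc, hdeg⟩ := ih (by omega)
      set e := (F - P ^ 2).coeff (2 * m - r - 1) with he
      set T : ℚ[X] := C (e / (2 * c)) * X ^ (m - r - 1) with hT
      have hTn : T.natDegree ≤ m - r - 1 := natDegree_C_mul_X_pow_le _ _
      have hP0 : P ≠ 0 := by rintro rfl; exact hc0 (by simpa using hPc.symm)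
      have hTdeg : T.degree < P.degree := by
        rw [degree_eq_natDegree hP0, hP]
        exact (degree_C_mul_X_pow_le _ _).trans_lt (by exact_mod_cast (by omega))
      refine ⟨P + T, ?_, ?_, ?_⟩
      · rw [natDegree_add_eq_left_of_degree_lt hTdeg, hP]
      · rw [leadingCoeff_add_of_degree_lt' hTdeg, hPc]
      · have hexp : F - (P + T) ^ 2 = (F - P ^ 2) - (2 * P * T + T ^ 2) := by ring
        have hcoeff : (F - (P + T) ^ 2).coeff (2 * m - r - 1) = 0 := by
          rw [hexp, coeff_sub, ← he, coeff_add]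
          have h1 : (2 * P * T).coeff (2 * m - r - 1) = e := by
            rw [hT, ← mul_assoc, show 2 * m - r - 1 = m + (m - r - 1) by omega, coeff_mul_X_pow,
              coeff_mul_C, ← hP, two_mul, coeff_add, coeff_natDegree, hPc]
            field_simp
            ring
          have h2 : (T ^ 2).coeff (2 * m - r - 1) = 0 := by
            refine coeff_eq_zero_of_natDegree_lt (natDegree_pow_le.trans_lt ?_)
            omega
          rw [h1, h2]; ring
        rw [degree_lt_iff_coeff_zero] at hdeg ⊢
        intro i hi
        obtain rfl | hi' : i = 2 * m - r - 1 ∨ 2 * m - r ≤ i := by omega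
        · exact hcoeff
        · have h1 : (2 * P * T).natDegree < i := by
            refine (natDegree_mul_le (p := 2 * P)).trans_lt ?_
            have : (2 * P).natDegree ≤ m := by
              rw [two_mul]; exact (natDegree_add_le _ _).trans (by simp [hP])
            omega
          have h2 : (T ^ 2).natDegree < i := natDegree_pow_le.trans_lt (by omega)
          rw [hexp, coeff_sub, coeff_add, hdeg i hi', coeff_eq_zero_of_natDegree_lt h1,
            coeff_eq_zero_of_natDegree_lt h2]
          ring
  obtain ⟨P, hP, hPc, hdeg⟩ := key m le_rfl
  refine ⟨P, F - P ^ 2, by ring, hP, hPc, ?_⟩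
  rwa [show 2 * m - m = m by omega] at hdeg

theorem AbsoluteValue.sub_one_le_or_add_one_le (v : AbsoluteValue ℚ ℝ) {δ η : ℝ} (hδ : 0 < δ)
    (hη1 : η ≤ 1) (hη : 3 * η ≤ δ ^ 2) {t e e' : ℚ} (he : v e ≤ η) (he' : v e' ≤ η)
    (ht : t ^ 2 = (1 + e) * (1 + e')) : v (t - 1) ≤ δ ∨ v (t + 1) ≤ δ := by
  by_contra! h
  have h1 : δ * δ < v (t - 1) * v (t + 1) := by
    have := h.1; have := h.2
    gcongr
  have h2 : v (t - 1) * v (t + 1) ≤ 3 * η := by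
    rw [← map_mul, show (t - 1) * (t + 1) = e + (e' + e * e') by linear_combination ht]
    have hη0 : 0 ≤ η := (v.nonneg _).trans he
    have : v (e * e') ≤ η * 1 := by
      rw [map_mul]
      exact mul_le_mul he (he'.trans hη1) (v.nonneg _) hη0
    linarith [v.add_le e (e' + e * e'), v.add_le e' (e * e')]
  nlinarith

theorem AbsoluteValue.half_le_add_one (v : AbsoluteValue ℚ ℝ) {δ η : ℝ} (hδ : 0 < δ)
    (hδ1 : 18 * δ ≤ 1) (hδ2 : 18 * δ ≤ v 2) (hη : 3 * η ≤ δ ^ 2) {t t' s e e₁ e₂ e₃ : ℚ}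
    (he : v e ≤ η) (he₁ : v e₁ ≤ η) (he₂ : v e₂ ≤ η) (he₃ : v e₃ ≤ η)
    (ht : t ^ 2 = (1 + e) * (1 + e₁)) (ht' : t' ^ 2 = (1 + e) * (1 + e₂))
    (hs : t * t' = (1 + e) * s) (hsign : v (t - 1) ≤ δ ↔ v (t' - 1) ≤ δ) :
    v 2 / 2 ≤ v (s + (1 + e₃)) := by
  have hηδ : η ≤ δ := by nlinarith
  have hη1 : η ≤ 1 := by linarith
  have h1 : v (t * t' - 1) ≤ 3 * δ := by
    by_cases h : v (t - 1) ≤ δ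
    · have h' := hsign.1 h
      have hp : v ((t - 1) * (t' - 1)) ≤ δ * 1 := by
        rw [map_mul]; exact mul_le_mul h (by linarith) (v.nonneg _) hδ.le
      rw [show t * t' - 1 = (t - 1) * (t' - 1) + ((t - 1) + (t' - 1)) by ring]
      linarith [v.add_le ((t - 1) * (t' - 1)) ((t - 1) + (t' - 1)), v.add_le (t - 1) (t' - 1)]
    · have h' := fun h' => h (hsign.2 h')
      have ha := (v.sub_one_le_or_add_one_le hδ hη1 hη he he₁ ht).resolve_left h
      have hb := (v.sub_one_le_or_add_one_le hδ hη1 hη he he₂ ht').resolve_left h'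
      have hp : v ((t + 1) * (t' + 1)) ≤ δ * 1 := by
        rw [map_mul]; exact mul_le_mul ha (by linarith) (v.nonneg _) hδ.le
      rw [show t * t' - 1 = (t + 1) * (t' + 1) - ((t + 1) + (t' + 1)) by ring]
      linarith [v.sub_le_add ((t + 1) * (t' + 1)) ((t + 1) + (t' + 1)), v.add_le (t + 1) (t' + 1)]
  have h2 : v (s - 1) ≤ 8 * δ := by
    have ha : v ((1 + e) * (s - 1)) ≤ 4 * δ := by
      rw [show (1 + e) * (s - 1) = (t * t' - 1) - e by rw [hs]; ring]
      linarith [v.sub_le_add (t * t' - 1) e]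
    have hb : 1 / 2 ≤ v (1 + e) := by
      have := v.sub_le_add (1 + e) e
      rw [add_sub_cancel_right, map_one] at this
      linarith
    rw [map_mul] at ha
    nlinarith [v.nonneg (s - 1)]
  have h3 : v 2 ≤ v (s + (1 + e₃)) + v ((s - 1) + e₃) := by
    rw [show (2 : ℚ) = (s + (1 + e₃)) - ((s - 1) + e₃) by ring]
    refine (v.sub_le_add _ _).trans (le_of_eq ?_)
    congr 2
  linarith [v.add_le (s - 1) e₃]

/-- `t` is close to `1` at the place `v`; when `t ^ 2` is close enough to `1` this determines the
sign of `t` at `v`. -/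
def closeToOne (v : AbsoluteValue ℚ ℝ) (t : ℚ) : Prop := v (t - 1) ≤ min 1 (v 2) / 18

theorem AbsoluteValue.eventually_sub_eval_le (v : AbsoluteValue ℚ ℝ) {G₀ G₁ G₂ P R : ℚ[X]}
    {m₀ m₁ m₂ : ℕ} {l₀ l₁ l₂ : ℚ} (h₀ : G₀.natDegree = 2 * m₀) (h₁ : G₁.natDegree = 2 * m₁)
    (h₂ : G₂.natDegree = 2 * m₂) (hl₀ : G₀.leadingCoeff = l₀ ^ 2) (hl₁ : G₁.leadingCoeff = l₁ ^ 2)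
    (hl₂ : G₂.leadingCoeff = l₂ ^ 2) (h0 : l₀ ≠ 0) (h1 : l₁ ≠ 0) (h2 : l₂ ≠ 0)
    (hPR : G₁ * G₂ = P ^ 2 + R) (hP : P.natDegree = m₁ + m₂) (hPl : P.leadingCoeff = l₁ * l₂)
    (hR : R.degree < (m₁ + m₂ : ℕ)) {ε : ℝ} (hε : 0 < ε) :
    ∀ᶠ x in comap v atTop, ∀ c w₀ w₁ w₂ : ℚ, G₀.eval x = c * w₀ ^ 2 → G₁.eval x = c * w₁ ^ 2 →
      G₂.eval x = c * w₂ ^ 2 →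
      (closeToOne v (c * w₀ * w₁ / ((l₀ * x ^ m₀) * (l₁ * x ^ m₁))) ↔
        closeToOne v (c * w₀ * w₂ / ((l₀ * x ^ m₀) * (l₂ * x ^ m₂)))) →
      v (c * w₁ * w₂ - P.eval x) ≤ ε := by
  have hv2 : 0 < v 2 := v.pos two_ne_zero
  set δ := min 1 (v 2) / 18 with hδ
  have hδ0 : 0 < δ := by positivity
  have hδ1 : 18 * δ ≤ 1 := by rw [hδ]; linarith [min_le_left 1 (v 2)]
  have hδ2 : 18 * δ ≤ v 2 := by rw [hδ]; linarith [min_le_right 1 (v 2)]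
  set η := δ ^ 2 / 3 with hη
  have hη0 : 0 < η := by positivity
  have hη3 : 3 * η ≤ δ ^ 2 := by rw [hη]; linarith
  have hvl : 0 < v (l₁ * l₂) := v.pos (by positivity)
  have hbase : ∀ᶠ x in comap v atTop, 1 ≤ v x := tendsto_comap.eventually_ge_atTop _
  filter_upwards [v.eventually_eval_eq h₀ hl₀ (by positivity) hη0,
    v.eventually_eval_eq h₁ hl₁ (by positivity) hη0,
    v.eventually_eval_eq h₂ hl₂ (by positivity) hη0,
    v.eventually_eval_eq hP hPl (by positivity) hη0,
    v.eventually_eval_le hR (show 0 < ε * (v 2 / 2) * v (l₁ * l₂) by positivity), hbase]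
    with x ⟨e₀, he₀, hx₀⟩ ⟨e₁, he₁, hx₁⟩ ⟨e₂, he₂, hx₂⟩ ⟨e₃, he₃, hx₃⟩ hxR hx1
    c w₀ w₁ w₂ hw₀ hw₁ hw₂ hsign
  have hx0 : x ≠ 0 := by rintro rfl; rw [map_zero] at hx1; linarith
  have e0 : c * w₀ ^ 2 = (l₀ * x ^ m₀) ^ 2 * (1 + e₀) := by rw [← hw₀, hx₀]; ring
  have e1 : c * w₁ ^ 2 = (l₁ * x ^ m₁) ^ 2 * (1 + e₁) := by rw [← hw₁, hx₁]; ring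
  have e2 : c * w₂ ^ 2 = (l₂ * x ^ m₂) ^ 2 * (1 + e₂) := by rw [← hw₂, hx₂]; ring
  have eP : P.eval x = (l₁ * x ^ m₁) * (l₂ * x ^ m₂) * (1 + e₃) := by rw [hx₃]; ring
  have eR : R.eval x = (c * w₁ * w₂ - P.eval x) * (c * w₁ * w₂ + P.eval x) := by
    have := congrArg (eval x) hPR
    rw [eval_mul, hw₁, hw₂, eval_add, eval_pow] at this
    linear_combination -this
  have hA : v (l₁ * l₂) * v x ^ (m₁ + m₂) = v ((l₁ * x ^ m₁) * (l₂ * x ^ m₂)) := by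
    simp only [map_mul, map_pow]; ring
  have hA₀ : l₀ * x ^ m₀ ≠ 0 := by positivity
  have hA₁ : l₁ * x ^ m₁ ≠ 0 := by positivity
  have hA₂ : l₂ * x ^ m₂ ≠ 0 := by positivity
  generalize l₀ * x ^ m₀ = A₀ at *
  generalize l₁ * x ^ m₁ = A₁ at *
  generalize l₂ * x ^ m₂ = A₂ at *
  have hAv : 0 < v (A₁ * A₂) := v.pos (mul_ne_zero hA₁ hA₂)
  have key := v.half_le_add_one (t := c * w₀ * w₁ / (A₀ * A₁)) (t' := c * w₀ * w₂ / (A₀ * A₂))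
    (s := c * w₁ * w₂ / (A₁ * A₂)) hδ0 hδ1 hδ2 hη3 he₀ he₁ he₂ he₃
    (by field_simp; linear_combination (c * w₁ ^ 2) * e0 + A₀ ^ 2 * (1 + e₀) * e1)
    (by field_simp; linear_combination (c * w₂ ^ 2) * e0 + A₀ ^ 2 * (1 + e₀) * e2)
    (by field_simp; linear_combination (c * w₁ * w₂) * e0) hsign
  have hsum : c * w₁ * w₂ + P.eval x = A₁ * A₂ * (c * w₁ * w₂ / (A₁ * A₂) + (1 + e₃)) := by
    rw [eP]; field_simp
  have hlow : v (A₁ * A₂) * (v 2 / 2) ≤ v (c * w₁ * w₂ + P.eval x) := by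
    rw [hsum, map_mul v (A₁ * A₂)]; gcongr
  have hup : v (c * w₁ * w₂ - P.eval x) * v (c * w₁ * w₂ + P.eval x) ≤
      ε * (v (A₁ * A₂) * (v 2 / 2)) := by
    rw [← map_mul, ← eR, ← hA]
    refine hxR.trans (le_of_eq (by ring))
  have hpos : 0 < v (A₁ * A₂) * (v 2 / 2) := by positivity
  have := mul_le_mul_of_nonneg_left hlow (v.nonneg (c * w₁ * w₂ - P.eval x))
  exact le_of_mul_le_mul_right (this.trans hup) hpos

theorem Polynomial.exists_int_mul_eval_mem (R : Subring ℚ) (P : ℚ[X]) :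
    ∃ N : ℤ, N ≠ 0 ∧ ∀ x ∈ R, (N : ℚ) * P.eval x ∈ R := by
  obtain ⟨N, hN, h⟩ := IsLocalization.integerNormalization_spec (nonZeroDivisors ℤ) P
  refine ⟨N, nonZeroDivisors.ne_zero hN, fun x hx => ?_⟩
  have h' := congrArg (eval x) h
  rw [eval_smul, zsmul_eq_mul, eval_map, eval₂_eq_sum_range] at h'
  rw [← h']
  refine R.sum_mem fun i _ => R.mul_mem ?_ (R.pow_mem hx i)
  rw [eq_intCast]
  exact intCast_mem R _

/-- Runge's method for a fixed triple of polynomials. -/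
theorem finite_setOf_runge (V : Finset (AbsoluteValue ℚ ℝ)) (R : Subring ℚ)
    (hprod : ∀ z ∈ R, z ≠ 0 → 1 ≤ ∏ v ∈ V, v z)
    (hfin : ∀ B : AbsoluteValue ℚ ℝ → ℝ, {z ∈ R | ∀ v ∈ V, v z ≤ B v}.Finite)
    {G₀ G₁ G₂ : ℚ[X]} {m₀ m₁ m₂ : ℕ} {l₀ l₁ l₂ : ℚ} (h₀ : G₀.natDegree = 2 * m₀)
    (h₁ : G₁.natDegree = 2 * m₁) (h₂ : G₂.natDegree = 2 * m₂) (hl₀ : G₀.leadingCoeff = l₀ ^ 2)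
    (hl₁ : G₁.leadingCoeff = l₁ ^ 2) (hl₂ : G₂.leadingCoeff = l₂ ^ 2) (h0 : l₀ ≠ 0) (h1 : l₁ ≠ 0)
    (h2 : l₂ ≠ 0) (hsq : ¬ IsSquare (G₁ * G₂)) :
    {x ∈ R | ∃ c ∈ R, ∃ w₀ ∈ R, ∃ w₁ ∈ R, ∃ w₂ ∈ R, G₀.eval x = c * w₀ ^ 2 ∧
      G₁.eval x = c * w₁ ^ 2 ∧ G₂.eval x = c * w₂ ^ 2 ∧
      ∀ v ∈ V, (closeToOne v (c * w₀ * w₁ / ((l₀ * x ^ m₀) * (l₁ * x ^ m₁))) ↔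
        closeToOne v (c * w₀ * w₂ / ((l₀ * x ^ m₀) * (l₂ * x ^ m₂))))}.Finite := by
  classical
  have hG₁ : G₁ ≠ 0 := by
    rintro rfl
    rw [leadingCoeff_zero] at hl₁
    exact pow_ne_zero 2 h1 hl₁.symm
  have hG₂ : G₂ ≠ 0 := by
    rintro rfl
    rw [leadingCoeff_zero] at hl₂
    exact pow_ne_zero 2 h2 hl₂.symm
  obtain ⟨P, S, hPS, hP, hPl, hS⟩ := Polynomial.exists_eq_sq_add (F := G₁ * G₂) (m := m₁ + m₂)
    (c := l₁ * l₂) (by rw [natDegree_mul hG₁ hG₂, h₁, h₂]; ring)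
    (by rw [leadingCoeff_mul, hl₁, hl₂]; ring) (mul_ne_zero h1 h2)
  have hS0 : S ≠ 0 := by
    rintro rfl
    exact hsq ⟨P, by rw [hPS]; ring⟩
  obtain ⟨N, hN0, hN⟩ := Polynomial.exists_int_mul_eval_mem R P
  have hev := fun (v : AbsoluteValue ℚ ℝ) (ε : ℝ) (hε : 0 < ε) =>
    v.eventually_sub_eval_le h₀ h₁ h₂ hl₀ hl₁ hl₂ h0 h1 h2 hPS hP hPl hS hε
  have hev' : ∀ (v : AbsoluteValue ℚ ℝ) (ε : ℝ), 0 < ε → ∃ B : ℝ, ∀ x : ℚ, B < v x →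
      ∀ c w₀ w₁ w₂ : ℚ, G₀.eval x = c * w₀ ^ 2 → G₁.eval x = c * w₁ ^ 2 →
      G₂.eval x = c * w₂ ^ 2 →
      (closeToOne v (c * w₀ * w₁ / ((l₀ * x ^ m₀) * (l₁ * x ^ m₁))) ↔
        closeToOne v (c * w₀ * w₂ / ((l₀ * x ^ m₀) * (l₂ * x ^ m₂)))) →
      v (c * w₁ * w₂ - P.eval x) ≤ ε := by
    intro v ε hε
    obtain ⟨s, hs, hsub⟩ := mem_comap.1 (hev v ε hε)
    obtain ⟨B, hB⟩ := mem_atTop_sets.1 hs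
    exact ⟨B, fun x hx => hsub (hB _ hx.le)⟩
  have hbdd : ∀ v : AbsoluteValue ℚ ℝ, ∃ K : ℝ, 1 ≤ K ∧ ∀ x c w₀ w₁ w₂ : ℚ,
      G₀.eval x = c * w₀ ^ 2 → G₁.eval x = c * w₁ ^ 2 → G₂.eval x = c * w₂ ^ 2 →
      (closeToOne v (c * w₀ * w₁ / ((l₀ * x ^ m₀) * (l₁ * x ^ m₁))) ↔
        closeToOne v (c * w₀ * w₂ / ((l₀ * x ^ m₀) * (l₂ * x ^ m₂)))) →
      v (c * w₁ * w₂ - P.eval x) ≤ K := by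
    intro v
    obtain ⟨B, hB⟩ := hev' v 1 one_pos
    have hbd : ∀ p : ℚ[X], ∃ K : ℝ, 0 ≤ K ∧ ∀ x, v x ≤ B → v (p.eval x) ≤ K := fun p =>
      ⟨|∑ i ∈ Finset.range (p.natDegree + 1), v (p.coeff i) * B ^ i|, abs_nonneg _,
        fun x hx => (v.eval_le_sum p x hx).trans (le_abs_self _)⟩
    obtain ⟨K₁, hK₁, hK₁'⟩ := hbd (G₁ * G₂)
    obtain ⟨K₂, hK₂, hK₂'⟩ := hbd P
    refine ⟨1 + K₁ + K₂, by linarith, fun x c w₀ w₁ w₂ e₀ e₁ e₂ hs => ?_⟩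
    rcases lt_or_ge B (v x) with hx | hx
    · linarith [hB x hx c w₀ w₁ w₂ e₀ e₁ e₂ hs]
    · have hy : v (c * w₁ * w₂) ≤ 1 + K₁ := by
        have h := hK₁' x hx
        rw [eval_mul, e₁, e₂, show c * w₁ ^ 2 * (c * w₂ ^ 2) = (c * w₁ * w₂) ^ 2 by ring,
          map_pow] at h
        nlinarith [v.nonneg (c * w₁ * w₂)]
      linarith [v.sub_le_add (c * w₁ * w₂) (P.eval x), hK₂' x hx]
  choose K hK1 hK using hbdd
  have hNV : 0 < ∏ v ∈ V, v (N : ℚ) := Finset.prod_pos fun v _ => v.pos (by exact_mod_cast hN0)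
  have hKV : 0 < ∏ v ∈ V, K v := Finset.prod_pos fun v _ => zero_lt_one.trans_le (hK1 v)
  set ε : ℝ := 1 / (2 * ((∏ v ∈ V, v (N : ℚ)) * ∏ v ∈ V, K v)) with hε
  have hε0 : 0 < ε := by positivity
  choose T hT using fun v => hev' v ε hε0
  refine ((hfin T).union (S.rootSet_finite ℚ)).subset ?_
  rintro x ⟨hxR, c, hc, w₀, hw₀, w₁, hw₁, w₂, hw₂, e₀, e₁, e₂, hs⟩
  by_cases hxT : ∀ v ∈ V, v x ≤ T v
  · exact Or.inl ⟨hxR, hxT⟩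
  · right
    push Not at hxT
    obtain ⟨u, huV, hu⟩ := hxT
    have hz : c * w₁ * w₂ - P.eval x = 0 := by
      by_contra hz
      have hmem : (N : ℚ) * (c * w₁ * w₂ - P.eval x) ∈ R := by
        rw [mul_sub]
        exact R.sub_mem (R.mul_mem (intCast_mem R N) (R.mul_mem (R.mul_mem hc hw₁) hw₂))
          (hN x hxR)
      have h3 := hprod _ hmem (mul_ne_zero (by exact_mod_cast hN0) hz)
      simp_rw [map_mul, Finset.prod_mul_distrib] at h3
      have h4 : ∏ v ∈ V, v (c * w₁ * w₂ - P.eval x) ≤ ε * ∏ v ∈ V, K v := by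
        rw [← Finset.mul_prod_erase V _ huV]
        have h5 : ∏ v ∈ V.erase u, v (c * w₁ * w₂ - P.eval x) ≤ ∏ v ∈ V.erase u, K v :=
          Finset.prod_le_prod (fun v _ => v.nonneg _) fun v hv =>
            hK v x c w₀ w₁ w₂ e₀ e₁ e₂ (hs v (Finset.mem_of_mem_erase hv))
        have h6 : ∏ v ∈ V.erase u, K v ≤ ∏ v ∈ V, K v := by
          rw [← Finset.mul_prod_erase V _ huV]
          exact le_mul_of_one_le_left
            (Finset.prod_nonneg fun v _ => zero_le_one.trans (hK1 v)) (hK1 u)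
        exact mul_le_mul (hT u x hu c w₀ w₁ w₂ e₀ e₁ e₂ (hs u huV)) (h5.trans h6)
          (Finset.prod_nonneg fun v _ => v.nonneg _) hε0.le
      have h7 := h3.trans (mul_le_mul_of_nonneg_left h4 hNV.le)
      rw [hε] at h7
      field_simp at h7
      norm_num at h7
    rw [mem_rootSet]
    refine ⟨hS0, ?_⟩
    have := congrArg (eval x) hPS
    rw [eval_mul, e₁, e₂, eval_add, eval_pow] at this
    rw [coe_aeval_eq_eval]
    linear_combination -this + (c * w₁ * w₂ + P.eval x) * hz

/-- Runge's method: the values of sufficiently many polynomials of even degree at a common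
`S`-integral point are not all squares up to finitely many constants, with finitely many
exceptions. -/
theorem finite_setOf_forall_eval_eq_mul_sq (V : Finset (AbsoluteValue ℚ ℝ)) (R : Subring ℚ)
    (hprod : ∀ z ∈ R, z ≠ 0 → 1 ≤ ∏ v ∈ V, v z)
    (hfin : ∀ B : AbsoluteValue ℚ ℝ → ℝ, {z ∈ R | ∀ v ∈ V, v z ≤ B v}.Finite)
    {G : ℕ → ℚ[X]} {m : ℕ → ℕ} {l : ℕ → ℚ} (hG : ∀ i, (G i).natDegree = 2 * m i)
    (hl : ∀ i, (G i).leadingCoeff = l i ^ 2) (hl0 : ∀ i, l i ≠ 0)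
    (hsq : ∀ i j, i < j → ¬ IsSquare (G i * G j)) (D : Finset ℚ) (hD : ∀ c ∈ D, c ∈ R) :
    ∃ K : ℕ, {x ∈ R | ∀ i < K, ∃ c ∈ D, ∃ w ∈ R, (G i).eval x = c * w ^ 2}.Finite := by
  classical
  set K := (D ×ˢ V.powerset).card + 1 with hK
  refine ⟨K, ?_⟩
  have hf := fun (i j k : ℕ) (hjk : j < k) => finite_setOf_runge V R hprod hfin (hG i) (hG j) (hG k)
    (hl i) (hl j) (hl k) (hl0 i) (hl0 j) (hl0 k) (hsq j k hjk)
  have hf' : (⋃ t ∈ ((Finset.range K ×ˢ Finset.range K ×ˢ Finset.range K).filter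
      fun t : ℕ × ℕ × ℕ => t.2.1 < t.2.2),
      {x ∈ R | ∃ c ∈ R, ∃ w₀ ∈ R, ∃ w₁ ∈ R, ∃ w₂ ∈ R, (G t.1).eval x = c * w₀ ^ 2 ∧
      (G t.2.1).eval x = c * w₁ ^ 2 ∧ (G t.2.2).eval x = c * w₂ ^ 2 ∧
      ∀ v ∈ V, (closeToOne v (c * w₀ * w₁ / ((l t.1 * x ^ m t.1) * (l t.2.1 * x ^ m t.2.1))) ↔
        closeToOne v (c * w₀ * w₂ / ((l t.1 * x ^ m t.1) * (l t.2.2 * x ^ m t.2.2))))}).Finite :=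
    Set.Finite.biUnion (Finset.finite_toSet _) fun t ht => hf _ _ _ (Finset.mem_filter.1 ht).2
  refine hf'.subset ?_
  rintro x ⟨hxR, hx⟩
  choose! c hcD w hwR hw using hx
  set b : ℕ → ℕ := fun j => Function.invFunOn c (Finset.range K) (c j) with hb
  have hb1 : ∀ j < K, b j < K := fun j hj => Finset.mem_range.1
    (Function.invFunOn_mem (s := (Finset.range K : Set ℕ)) ⟨j, by simpa using hj, rfl⟩)
  have hb2 : ∀ j < K, c (b j) = c j := fun j hj =>
    Function.invFunOn_eq (s := (Finset.range K : Set ℕ)) ⟨j, by simpa using hj, rfl⟩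
  set t : ℕ → ℚ := fun j => c j * w (b j) * w j / ((l (b j) * x ^ m (b j)) * (l j * x ^ m j))
    with ht
  obtain ⟨j, hj, k, hk, hne, heq⟩ := Finset.exists_ne_map_eq_of_card_lt_of_maps_to
    (s := Finset.range K) (t := D ×ˢ V.powerset)
    (f := fun j => (c j, V.filter fun v => closeToOne v (t j)))
    (by rw [Finset.card_range, hK]; omega)
    (fun j hj => by
      simp only [Finset.coe_range, Set.mem_Iio] at hj
      simp only [Finset.coe_product, Set.mem_prod, Finset.mem_coe, Finset.mem_powerset]
      exact ⟨hcD j hj, Finset.filter_subset _ _⟩)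
  wlog hlt : j < k generalizing j k
  · exact this k hk j hj hne.symm heq.symm (by omega)
  rw [Finset.mem_range] at hj hk
  obtain ⟨hc, hV⟩ := Prod.mk.inj heq
  have hbjk : b j = b k := by simp only [hb, hc]
  simp only [Set.mem_iUnion]
  refine ⟨(b j, j, k), ?_, hxR, c j, hD _ (hcD j hj), w (b j), hwR _ (hb1 j hj), w j, hwR j hj,
    w k, hwR k hk, ?_, hw j hj, ?_, fun v hv => ?_⟩
  · simp [hb1 j hj, hj, hk, hlt]
  · rw [← hb2 j hj]; exact hw _ (hb1 j hj)
  · rw [hc]; exact hw k hk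
  · have := Finset.ext_iff.1 hV v
    simp only [Finset.mem_filter, hv, true_and, ht, ← hbjk, ← hc] at this
    exact this

end Runge

section SIntegers

/-- The ring `ℤ[1/a]`. -/
def sIntegers (a : ℤ) : Subring ℚ where
  carrier := {z | ∃ (k : ℕ) (u : ℤ), z * (a : ℚ) ^ k = u}
  mul_mem' := by
    rintro x y ⟨k, u, hx⟩ ⟨l, w, hy⟩
    exact ⟨k + l, u * w, by push_cast; rw [← hx, ← hy]; ring⟩
  one_mem' := ⟨0, 1, by simp⟩
  add_mem' := by
    rintro x y ⟨k, u, hx⟩ ⟨l, w, hy⟩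
    exact ⟨k + l, u * a ^ l + w * a ^ k, by push_cast; rw [← hx, ← hy]; ring⟩
  zero_mem' := ⟨0, 0, by simp⟩
  neg_mem' := by
    rintro x ⟨k, u, hx⟩
    exact ⟨k, -u, by push_cast; rw [← hx]; ring⟩

theorem mem_sIntegers {a : ℤ} {z : ℚ} :
    z ∈ sIntegers a ↔ ∃ (k : ℕ) (u : ℤ), z * (a : ℚ) ^ k = u := Iff.rfl

theorem div_pow_mem_sIntegers {a : ℤ} (ha : a ≠ 0) (u : ℤ) (k : ℕ) :
    (u : ℚ) / (a : ℚ) ^ k ∈ sIntegers a :=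
  ⟨k, u, div_mul_cancel₀ _ (pow_ne_zero _ (by exact_mod_cast ha))⟩

/-- The `p`-adic absolute value for `p` prime, and the real one otherwise. -/
noncomputable def ratPlace (p : ℕ) : AbsoluteValue ℚ ℝ :=
  if h : p.Prime then @Rat.AbsoluteValue.padic p ⟨h⟩ else Rat.AbsoluteValue.real

theorem ratPlace_of_prime (p : ℕ) [hp : Fact p.Prime] (r : ℚ) : ratPlace p r = padicNorm p r := by
  rw [ratPlace, dif_pos hp.out, Rat.AbsoluteValue.padic_eq_padicNorm]

theorem ratPlace_one (r : ℚ) : ratPlace 1 r = |r| := by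
  rw [ratPlace, dif_neg Nat.not_prime_one, Rat.AbsoluteValue.real_eq_abs]

theorem ratPlace_le_inv (p : ℕ) [hp : Fact p.Prime] {u : ℤ} (hu : (p : ℤ) ∣ u) :
    ratPlace p u ≤ (p : ℝ)⁻¹ := by
  obtain ⟨w, rfl⟩ := hu
  rw [ratPlace_of_prime]
  push_cast
  rw [padicNorm.mul, padicNorm.padicNorm_p_of_prime]
  push_cast
  have h : ((padicNorm p (w : ℚ) : ℚ) : ℝ) ≤ 1 := by exact_mod_cast padicNorm.of_int (p := p) w
  exact mul_le_of_le_one_right (by positivity) h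

open Classical in
/-- The archimedean absolute value together with the `p`-adic ones for `p ∣ a`. -/
noncomputable def ratPlaces (a : ℤ) : Finset (AbsoluteValue ℚ ℝ) :=
  (insert 1 a.natAbs.primeFactors).image ratPlace

theorem injOn_ratPlace (a : ℤ) : Set.InjOn ratPlace (insert 1 a.natAbs.primeFactors : Finset ℕ) := by
  have key : ∀ p q : ℕ, p.Prime → q = 1 ∨ q.Prime → ratPlace p = ratPlace q → p = q := by
    intro p q hp hq h
    have : Fact p.Prime := ⟨hp⟩
    by_contra hne
    have h1 : ratPlace p p < 1 := by
      rw [ratPlace_of_prime]; exact_mod_cast padicNorm.padicNorm_p_lt_one_of_prime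
    rw [h] at h1
    rcases hq with rfl | hq
    · rw [ratPlace_one] at h1
      have : (1 : ℝ) ≤ p := by exact_mod_cast hp.one_lt.le
      push_cast at h1
      rw [Nat.abs_cast] at h1
      linarith
    · have : Fact q.Prime := ⟨hq⟩
      rw [ratPlace_of_prime, padicNorm.padicNorm_of_prime_of_ne (fun h => hne h.symm)] at h1
      norm_num at h1
  intro p hp q hq h
  simp only [Finset.coe_insert, Set.mem_insert_iff, Finset.mem_coe, Nat.mem_primeFactors] at hp hq
  rcases hp with rfl | hp
  · rcases hq with rfl | hq
    · rfl
    · exact (key q 1 hq.1 (Or.inl rfl) h.symm).symm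
  · exact key p q hp.1 (hq.imp id (·.1)) h

theorem prod_ratPlaces (a : ℤ) (r : ℚ) : ∏ v ∈ ratPlaces a, v r =
    (|r| : ℚ) * ∏ p ∈ a.natAbs.primeFactors, ratPlace p r := by
  classical
  rw [ratPlaces, Finset.prod_image (injOn_ratPlace a), Finset.prod_insert, ratPlace_one]
  exact fun h => Nat.not_prime_one (Nat.prime_of_mem_primeFactors h)

theorem ratPlace_intCast_mul_pow {p : ℕ} (hp : p.Prime) {u : ℤ} (hu : u ≠ 0) :
    ratPlace p u = ((p : ℝ) ^ u.natAbs.factorization p)⁻¹ := by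
  have : Fact p.Prime := ⟨hp⟩
  rw [ratPlace_of_prime, padicNorm.eq_zpow_of_nonzero (by exact_mod_cast hu), padicValRat.of_int,
    zpow_neg, zpow_natCast, Nat.factorization_def _ hp]
  push_cast
  rfl

theorem prod_ratPlaces_intCast (a : ℤ) {u : ℤ} (hu : u ≠ 0) : ∏ v ∈ ratPlaces a, v (u : ℚ) =
    (u.natAbs : ℝ) / ((∏ p ∈ a.natAbs.primeFactors, p ^ u.natAbs.factorization p : ℕ) : ℝ) := by
  rw [prod_ratPlaces, Finset.prod_congr rfl fun p hp =>
    ratPlace_intCast_mul_pow (Nat.prime_of_mem_primeFactors hp) hu, Finset.prod_inv_distrib,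
    div_eq_mul_inv]
  congr 1
  · rw [← Int.cast_abs, Int.abs_eq_natAbs]; simp
  · push_cast; rfl

theorem one_le_prod_ratPlaces {a : ℤ} (ha : a ≠ 0) {z : ℚ} (hz : z ∈ sIntegers a) (hz0 : z ≠ 0) :
    1 ≤ ∏ v ∈ ratPlaces a, v z := by
  obtain ⟨k, u, hzu⟩ := hz
  have ha' : (a : ℚ) ≠ 0 := by exact_mod_cast ha
  have hu : u ≠ 0 := by
    rintro rfl
    rw [Int.cast_zero] at hzu
    exact mul_ne_zero hz0 (pow_ne_zero _ ha') hzu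
  have h1 : ∏ v ∈ ratPlaces a, v (a : ℚ) = 1 := by
    rw [prod_ratPlaces_intCast a ha]
    have : ∏ p ∈ a.natAbs.primeFactors, p ^ a.natAbs.factorization p = a.natAbs :=
      Nat.prod_factorization_pow_eq_self (Int.natAbs_ne_zero.2 ha)
    rw [this, div_self]
    exact_mod_cast Int.natAbs_ne_zero.2 ha
  have h2 : 1 ≤ ∏ v ∈ ratPlaces a, v (u : ℚ) := by
    rw [prod_ratPlaces_intCast a hu, one_le_div]
    · norm_cast
      refine Nat.le_of_dvd (Int.natAbs_pos.2 hu) (Finset.prod_dvd_of_isRelPrime ?_ ?_)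
      · intro p hp q hq hpq
        rw [Function.onFun, ← Nat.coprime_iff_isRelPrime]
        exact Nat.coprime_pow_primes _ _ (Nat.prime_of_mem_primeFactors hp)
          (Nat.prime_of_mem_primeFactors hq) hpq
      · exact fun p _ => Nat.ordProj_dvd _ _
    · norm_cast
      exact Finset.prod_pos fun p hp => pow_pos (Nat.prime_of_mem_primeFactors hp).pos _
  simpa [← hzu, Finset.prod_mul_distrib, Finset.prod_pow, h1] using h2

theorem finite_sIntegers_le {a : ℤ} (ha : a ≠ 0) (B : AbsoluteValue ℚ ℝ → ℝ) :
    {z ∈ sIntegers a | ∀ v ∈ ratPlaces a, v z ≤ B v}.Finite := by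
  classical
  have ha' : (a : ℚ) ≠ 0 := by exact_mod_cast ha
  obtain ⟨e, he⟩ : ∃ e : ℕ, ∀ v ∈ ratPlaces a, B v ≤ 2 ^ e := by
    obtain ⟨e, he⟩ := pow_unbounded_of_one_lt (∑ v ∈ ratPlaces a, |B v|) (one_lt_two (α := ℝ))
    refine ⟨e, fun v hv => (le_abs_self _).trans (le_trans ?_ he.le)⟩
    exact Finset.single_le_sum (f := fun v => |B v|) (fun v _ => abs_nonneg _) hv
  obtain ⟨M, hM⟩ := exists_nat_ge (|(a : ℝ)| ^ e * 2 ^ e)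
  have hsub : {z ∈ sIntegers a | ∀ v ∈ ratPlaces a, v z ≤ B v} ⊆
      (fun u : ℤ => (u : ℚ) / (a : ℚ) ^ e) '' (Set.Icc (-M : ℤ) M) := by
    rintro z ⟨⟨k, u, hzu⟩, hz⟩
    have hden : ((a : ℚ) ^ e * z).den = 1 := by
      by_contra hne
      obtain ⟨p, hp, hpd⟩ := Nat.exists_prime_and_dvd hne
      have : Fact p.Prime := ⟨hp⟩
      have hpa : (p : ℤ) ∣ a := by
        have h1 : (a : ℚ) ^ e * z = ((a ^ e * u : ℤ) : ℚ) / ((a ^ k : ℤ) : ℚ) := by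
          push_cast
          rw [eq_div_iff (pow_ne_zero _ ha'), ← hzu]; ring
        have h2 := Rat.den_dvd (a ^ e * u) (a ^ k)
        rw [← Rat.divInt_eq_div] at h1
        rw [← h1] at h2
        exact (Nat.prime_iff_prime_int.1 hp).dvd_of_dvd_pow
          ((Int.natCast_dvd_natCast.2 hpd).trans h2)
      have hpV : ratPlace p ∈ ratPlaces a := by
        refine Finset.mem_image_of_mem _ (Finset.mem_insert_of_mem ?_)
        rw [Nat.mem_primeFactors]
        exact ⟨hp, Int.natCast_dvd.1 hpa, Int.natAbs_ne_zero.2 ha⟩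
      have hle : ratPlace p ((a : ℚ) ^ e * z) ≤ 1 := by
        rw [map_mul, map_pow]
        calc ratPlace p (a : ℚ) ^ e * ratPlace p z ≤ ((2 : ℝ)⁻¹) ^ e * 2 ^ e := by
              gcongr
              · refine (ratPlace_le_inv p hpa).trans ?_
                have : (2 : ℝ) ≤ p := by exact_mod_cast hp.two_le
                gcongr
              · exact (hz _ hpV).trans (he _ hpV)
          _ = 1 := by rw [← mul_pow]; norm_num
      set q := (a : ℚ) ^ e * z with hq
      have hqd : q * (q.den : ℚ) = q.num := Rat.mul_den_eq_num q
      have h3 : padicNorm p (q.num : ℚ) = 1 := by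
        rw [padicNorm.int_eq_one_iff]
        intro h
        have := Nat.dvd_gcd (Int.natCast_dvd.1 h) hpd
        rw [q.reduced.gcd_eq_one] at this
        exact hp.one_lt.ne' (Nat.dvd_one.1 this)
      have h4 : padicNorm p (q.den : ℚ) < 1 := (padicNorm.nat_lt_one_iff _).2 hpd
      rw [ratPlace_of_prime] at hle
      have hle' : padicNorm p q ≤ 1 := by exact_mod_cast hle
      rw [← hqd, padicNorm.mul] at h3
      nlinarith [padicNorm.nonneg (p := p) q, padicNorm.nonneg (p := p) (q.den : ℚ)]
    have hnum : (a : ℚ) ^ e * z = ((a : ℚ) ^ e * z).num := (Rat.den_eq_one_iff _).1 hden |>.symm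
    have h1V : ratPlace 1 ∈ ratPlaces a :=
      Finset.mem_image_of_mem _ (Finset.mem_insert_self _ _)
    refine ⟨((a : ℚ) ^ e * z).num, ?_, ?_⟩
    · rw [Set.mem_Icc, ← abs_le]
      have h5 : |(((a : ℚ) ^ e * z : ℚ) : ℝ)| ≤ M := by
        refine le_trans ?_ hM
        push_cast
        rw [abs_mul, abs_pow]
        gcongr
        have h6 := (hz _ h1V).trans (he _ h1V)
        rw [ratPlace_one] at h6
        exact_mod_cast h6
      rw [hnum] at h5
      exact_mod_cast h5
    · change _ / _ = _
      rw [← hnum, mul_div_cancel_left₀ _ (pow_ne_zero _ ha')]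
  exact ((Set.finite_Icc _ _).image _).subset hsub

end SIntegers

section CritValue

/-- The integer `ℓ a ^ (d ^ n) f^(n)(-b / a)`, where `ℓ` is the leading coefficient of `f`. -/
noncomputable def critValue (f : ℤ[X]) (a b : ℤ) (n : ℕ) : ℤ :=
  f.leadingCoeff * ((polyIter f n).scaleRoots a).eval (-b)

theorem map_critValue {K : Type*} [Field K] (φ : ℤ →+* K) (f : ℤ[X]) {a : ℤ} (b : ℤ)
    (ha : φ a ≠ 0) (n : ℕ) :
    φ (critValue f a b n) = φ a ^ f.natDegree ^ n *
      (φ f.leadingCoeff * (polyIter (f.map φ) n).eval (-φ b / φ a)) := by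
  have h := scaleRoots_eval₂_mul (p := polyIter f n) φ (-φ b / φ a) a
  rw [mul_div_cancel₀ _ ha, ← map_neg, eval₂_hom, natDegree_polyIter, ← eval_map,
    map_polyIter] at h
  rw [critValue, map_mul, h, map_neg]
  ring

theorem even_natDegree_of_derivative_eq {f g : ℤ[X]} {a b : ℤ} (hdeg : 2 ≤ f.natDegree) (ha : a ≠ 0)
    (hder : derivative f = g ^ 2 * (C a * X + C b)) : Even f.natDegree := by
  have h1 := natDegree_eq_of_degree_eq_some (degree_derivative (p := f) (by omega))
  have hlin : (C a * X + C b).natDegree = 1 := natDegree_linear ha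
  have hg : g ≠ 0 := by
    rintro rfl
    rw [hder] at h1
    simp at h1
    omega
  have hl0 : (C a * X + C b : ℤ[X]) ≠ 0 := by
    intro h
    rw [h] at hlin
    simp at hlin
  rw [hder, natDegree_mul (pow_ne_zero _ hg) hl0, natDegree_pow, hlin] at h1
  exact ⟨g.natDegree + 1, by omega⟩

variable {f g : ℤ[X]} {a b : ℤ} {p : ℕ}

theorem jacobiSym_critValue (hdeg : 2 ≤ f.natDegree) (ha : a ≠ 0)
    (hder : derivative f = g ^ 2 * (C a * X + C b)) (hp : p.Prime) (hp2 : p ≠ 2)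
    (hpa : ¬ (p : ℤ) ∣ a) (hpf : ¬ (p : ℤ) ∣ f.leadingCoeff)
    (hirr : DynIrred (f.map (Int.castRingHom (ZMod p)))) {n : ℕ} (hn : 2 ≤ n) :
    jacobiSym (critValue f a b n) p = -1 := by
  have : Fact p.Prime := ⟨hp⟩
  set φ := Int.castRingHom (ZMod p) with hφ
  have ha' : φ a ≠ 0 := by
    rwa [hφ, eq_intCast, Ne, ZMod.intCast_zmod_eq_zero_iff_dvd]
  have hl' : φ f.leadingCoeff ≠ 0 := by
    rwa [hφ, eq_intCast, Ne, ZMod.intCast_zmod_eq_zero_iff_dvd]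
  have heven := even_natDegree_of_derivative_eq hdeg ha hder
  have hder' : derivative (f.map φ) = (g.map φ) ^ 2 * (C (φ a) * X + C (φ b)) := by
    rw [derivative_map, hder]
    simp
  have key := not_isSquare_leadingCoeff_mul_eval_polyIter (F := ZMod p)
    (by rwa [ZMod.ringChar_zmod_n]) ha' hder'
    (by rwa [natDegree_map_of_leadingCoeff_ne_zero φ hl']) hirr hn
  rw [leadingCoeff_map_of_leadingCoeff_ne_zero φ hl'] at key
  rw [← jacobiSym.legendreSym.to_jacobiSym, legendreSym.eq_neg_one_iff]
  change ¬ IsSquare (φ _)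
  rw [map_critValue φ f b ha' n]
  obtain ⟨e, he⟩ : Even (f.natDegree ^ n) := heven.pow_of_ne_zero (by omega)
  rintro ⟨y, hy⟩
  refine key ⟨y / φ a ^ e, ?_⟩
  rw [he, pow_add] at hy
  generalize φ f.leadingCoeff * _ = z at hy ⊢
  have := pow_ne_zero e ha'
  field_simp
  linear_combination hy

theorem eq_of_dvd_critValue (hpa : ¬ (p : ℤ) ∣ a) (hpf : ¬ (p : ℤ) ∣ f.leadingCoeff)
    (hp : p.Prime) (h0 : ∀ k, 1 ≤ k → ¬ (p : ℤ) ∣ (polyIter f k).eval 0) {m n : ℕ}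
    (hm : (p : ℤ) ∣ critValue f a b m) (hn : (p : ℤ) ∣ critValue f a b n) : m = n := by
  have : Fact p.Prime := ⟨hp⟩
  wlog hmn : m < n generalizing m n
  · rcases lt_trichotomy m n with h | h | h
    · exact absurd h hmn
    · exact h
    · exact (this hn hm h).symm
  set φ := Int.castRingHom (ZMod p) with hφ
  have hzero : ∀ z : ℤ, φ z = 0 ↔ (p : ℤ) ∣ z := fun z => by
    rw [hφ, eq_intCast, ZMod.intCast_zmod_eq_zero_iff_dvd]
  rw [← hzero] at hpa hpf
  have key : ∀ k, (p : ℤ) ∣ critValue f a b k →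
      (polyIter (f.map φ) k).eval (-φ b / φ a) = 0 := by
    intro k hk
    rw [← hzero, map_critValue φ f b hpa] at hk
    exact (mul_eq_zero.1 ((mul_eq_zero.1 hk).resolve_left (pow_ne_zero _ hpa))).resolve_left hpf
  have h1 := key n hn
  obtain ⟨k, rfl⟩ := Nat.exists_eq_add_of_lt hmn
  rw [show m + k + 1 = (k + 1) + m by ring, eval_polyIter_add, key m hm, ← map_polyIter] at h1
  refine absurd ((hzero _).1 ?_) (h0 (k + 1) (by omega))
  rw [← h1, ← map_zero φ, eval_map_apply]

end CritValue

section InfinitelyManyPrimes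

variable {f : ℤ[X]}

theorem eval_zero_polyIter_ne_zero_of_dynIrred {p : ℕ} (hp : p.Prime) (hdeg : 2 ≤ f.natDegree)
    (hpf : ¬ (p : ℤ) ∣ f.leadingCoeff)
    (hirr : DynIrred (f.map (Int.castRingHom (ZMod p)))) {k : ℕ} (hk : 1 ≤ k) :
    (polyIter f k).eval 0 ≠ 0 := by
  have : Fact p.Prime := ⟨hp⟩
  intro h
  set φ := Int.castRingHom (ZMod p) with hφ
  have hl' : φ f.leadingCoeff ≠ 0 := by
    rwa [hφ, eq_intCast, Ne, ZMod.intCast_zmod_eq_zero_iff_dvd]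
  have h1 : (polyIter (f.map φ) k).IsRoot 0 := by
    rw [← map_polyIter, IsRoot.def, ← map_zero φ, eval_map_apply, h]
  have h2 := natDegree_polyIter (f.map φ) k
  rw [natDegree_eq_of_degree_eq_some (n := 1) (degree_eq_one_of_irreducible_of_root (hirr k hk) h1),
    natDegree_map_of_leadingCoeff_ne_zero φ hl'] at h2
  have := Nat.pow_le_pow_left hdeg k
  have := Nat.pow_le_pow_right (n := 2) two_pos hk
  rw [pow_one] at this
  omega

theorem not_isSquare_mul_polyIter_of_dynIrred (hdeg : 2 ≤ f.natDegree)
    (hinf : ∀ B : ℕ, ∃ p : ℕ, B ≤ p ∧ p.Prime ∧ DynIrred (f.map (Int.castRingHom (ZMod p))))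
    {i j : ℕ} (hi : 1 ≤ i) (hij : i < j) :
    ¬ IsSquare ((C f.leadingCoeff * polyIter f i).map (Int.castRingHom ℚ) *
      (C f.leadingCoeff * polyIter f j).map (Int.castRingHom ℚ)) := by
  rintro ⟨P, hP⟩
  obtain ⟨N, hN, hNP⟩ := IsLocalization.integerNormalization_spec (nonZeroDivisors ℤ) P
  set P₁ := IsLocalization.integerNormalization (nonZeroDivisors ℤ) P
  have hN0 : N ≠ 0 := nonZeroDivisors.ne_zero hN
  have hf0 : f.leadingCoeff ≠ 0 := by
    rw [leadingCoeff_ne_zero]; rintro rfl; simp at hdeg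
  have hZ : C (N * f.leadingCoeff) ^ 2 * (polyIter f i * polyIter f j) = P₁ * P₁ := by
    apply map_injective (Int.castRingHom ℚ) Int.cast_injective
    rw [algebraMap_int_eq] at hNP
    rw [Polynomial.map_mul (p := P₁), hNP, smul_mul_smul_comm, ← hP]
    simp [zsmul_eq_mul]
    ring
  obtain ⟨p, hpB, hp, hirr⟩ := hinf ((N * f.leadingCoeff).natAbs + 1)
  have : Fact p.Prime := ⟨hp⟩
  set φ := Int.castRingHom (ZMod p) with hφ
  have hcl : φ (N * f.leadingCoeff) ≠ 0 := by
    rw [hφ, eq_intCast, Ne, ZMod.intCast_zmod_eq_zero_iff_dvd, Int.natCast_dvd]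
    intro h
    have := Nat.le_of_dvd (Int.natAbs_pos.2 (mul_ne_zero hN0 hf0)) h
    omega
  have hl : φ f.leadingCoeff ≠ 0 := fun h => hcl (by rw [map_mul, h, mul_zero])
  have h1 := congrArg (Polynomial.map φ) hZ
  simp only [Polynomial.map_mul, Polynomial.map_pow, map_C, map_polyIter] at h1
  have hi' := hirr i hi
  have hj' := hirr j (by omega)
  obtain ⟨R, hR⟩ : polyIter (f.map φ) i ∣ P₁.map φ := by
    refine or_self_iff.1 (hi'.prime.dvd_or_dvd (a := P₁.map φ) (b := P₁.map φ) ?_)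
    rw [← h1]
    exact Dvd.intro_left (C (φ (N * f.leadingCoeff)) ^ 2 * polyIter (f.map φ) j) (by simp; ring)
  have h2 : C (φ (N * f.leadingCoeff)) ^ 2 * polyIter (f.map φ) j = polyIter (f.map φ) i * R ^ 2 := by
    apply mul_left_cancel₀ hi'.ne_zero
    rw [hR] at h1
    simp only [map_mul] at h1 ⊢
    linear_combination h1
  have h3 : polyIter (f.map φ) i ∣ polyIter (f.map φ) j := by
    have hu : IsUnit (C (φ (N * f.leadingCoeff)) ^ 2) :=
      (isUnit_C.2 (isUnit_iff_ne_zero.2 hcl)).pow 2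
    rw [← hu.dvd_mul_left, h2]
    exact dvd_mul_right _ _
  have h4 := natDegree_eq_of_degree_eq (degree_eq_degree_of_associated
    ((hi'.dvd_irreducible_iff_associated hj').1 h3))
  rw [natDegree_polyIter, natDegree_polyIter, natDegree_map_of_leadingCoeff_ne_zero φ hl] at h4
  exact hij.ne (Nat.pow_right_injective hdeg h4)

end InfinitelyManyPrimes

section Windows

theorem exists_eq_mul_sq_of_even_padicValInt {E M : ℤ} (hM : M ≠ 0)
    (h : ∀ p : ℕ, p.Prime → ¬ (p : ℤ) ∣ M → Even (padicValInt p E)) :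
    ∃ c y : ℤ, |c| ≤ |M| ∧ E = c * y ^ 2 := by
  rcases eq_or_ne E 0 with rfl | hE
  · exact ⟨0, 0, by simp, by simp⟩
  obtain ⟨s, y, hsy, hs⟩ := Nat.sq_mul_squarefree E.natAbs
  have hs0 : s ≠ 0 := hs.ne_zero
  have hy0 : y ≠ 0 := by
    rintro rfl
    exact hE (Int.natAbs_eq_zero.1 (by simpa using hsy.symm))
  have hdvd : s ∣ M.natAbs := by
    rw [← Nat.prod_primeFactors_of_squarefree hs]
    refine Finset.prod_primes_dvd _ (fun p hp => (Nat.prime_of_mem_primeFactors hp).prime) ?_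
    intro p hp
    have hpp := Nat.prime_of_mem_primeFactors hp
    have : Fact p.Prime := ⟨hpp⟩
    by_contra hpM
    have h1 := h p hpp (by rwa [Int.natCast_dvd])
    have h2 : padicValNat p s = 1 := by
      rw [← Nat.factorization_def _ hpp]
      exact Nat.factorization_eq_one_of_squarefree hs hpp (Nat.dvd_of_mem_primeFactors hp)
    rw [padicValInt, ← hsy, padicValNat.mul (pow_ne_zero _ hy0) hs0, padicValNat.pow, h2] at h1
    exact absurd h1 (by simp)
  have hle : (s : ℤ) ≤ |M| := by
    rw [Int.abs_eq_natAbs]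
    exact_mod_cast Nat.le_of_dvd (Int.natAbs_pos.2 hM) hdvd
  have hsy' : ((E.natAbs : ℕ) : ℤ) = s * (y : ℤ) ^ 2 := by rw [← hsy]; push_cast; ring
  rcases Int.natAbs_eq E with h3 | h3
  · exact ⟨s, y, by simpa using hle, by rw [h3, hsy']⟩
  · exact ⟨-s, y, by simpa using hle, by rw [h3, hsy']; ring⟩

variable {f : ℤ[X]}

theorem aeval_polyIter_rat (n : ℕ) (γ : ℚ) :
    aeval γ (polyIter f n) = (polyIter (f.map (Int.castRingHom ℚ)) n).eval γ := by
  rw [aeval_def, eval₂_eq_eval_map, algebraMap_int_eq, map_polyIter]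

theorem injective_aeval_polyIter {γ : ℚ} (hγ : ¬ IsPreperiodicPt f γ) :
    Function.Injective fun n => aeval γ (polyIter f n) := by
  intro m n hmn
  by_contra hne
  wlog h : m < n generalizing m n
  · exact this hmn.symm (Ne.symm hne) (by omega)
  refine hγ (((Finset.range n).finite_toSet.image fun n => aeval γ (polyIter f n)).subset ?_)
  rintro _ ⟨k, -, rfl⟩
  induction k using Nat.strong_induction_on with
  | _ k ih =>
    rcases lt_or_ge k n with hk | hk
    · exact ⟨k, by simpa using hk, rfl⟩
    · obtain ⟨j, rfl⟩ := Nat.exists_eq_add_of_le' hk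
      convert ih (j + m) (by omega) using 1
      simp only [aeval_polyIter_rat, eval_polyIter_add] at hmn ⊢
      rw [hmn]

theorem aeval_mem_sIntegers {a : ℤ} {γ : ℚ} (hγ : γ ∈ sIntegers a) (P : ℤ[X]) :
    aeval γ P ∈ sIntegers a := by
  have h := hom_eval₂ P (algebraMap ℤ (sIntegers a)) (sIntegers a).subtype ⟨γ, hγ⟩
  rw [aeval_def, ← show (sIntegers a).subtype.comp (algebraMap ℤ (sIntegers a)) =
    algebraMap ℤ ℚ from RingHom.ext_int _ _]
  exact h ▸ Subtype.property _

theorem exists_window (hdeg : 2 ≤ f.natDegree) (hd : Even f.natDegree) {a b : ℤ} (ha : a ≠ 0)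
    (hinf : ∀ B : ℕ, ∃ p : ℕ, B ≤ p ∧ p.Prime ∧ DynIrred (f.map (Int.castRingHom (ZMod p))))
    (hγ : ¬ IsPreperiodicPt f (-(b : ℚ) / (a : ℚ))) {M : ℤ} (hM : M ≠ 0) :
    ∃ K N : ℕ, ∀ n, N ≤ n → ∃ i < K, ∃ p : ℕ, p.Prime ∧ ¬ (p : ℤ) ∣ M ∧
      Odd (padicValInt p (critValue f a b (n + (i + 1)))) := by
  set φ := Int.castRingHom ℚ with hφ
  set γ : ℚ := -(b : ℚ) / (a : ℚ) with hγdef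
  have haQ : φ a ≠ 0 := by simpa [hφ] using ha
  have hf0 : f.leadingCoeff ≠ 0 := by
    rw [leadingCoeff_ne_zero]; rintro rfl; simp at hdeg
  obtain ⟨e, he⟩ := hd
  have hG : ∀ i, ((C f.leadingCoeff * polyIter f (i + 1)).map φ).natDegree =
      2 * (e * f.natDegree ^ i) := fun i => by
    rw [natDegree_map_eq_of_injective Int.cast_injective, natDegree_C_mul hf0, natDegree_polyIter,
      pow_succ]
    nth_rw 2 [he]
    ring
  have hl : ∀ i, ((C f.leadingCoeff * polyIter f (i + 1)).map φ).leadingCoeff =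
      (φ (f.leadingCoeff * (polyIter f i).leadingCoeff ^ e)) ^ 2 := fun i => by
    rw [leadingCoeff_map_of_injective Int.cast_injective, leadingCoeff_mul, leadingCoeff_C,
      leadingCoeff_polyIter_succ f (by omega), ← map_pow, he]
    congr 1
    ring
  have hl0 : ∀ i, φ (f.leadingCoeff * (polyIter f i).leadingCoeff ^ e) ≠ 0 := fun i => by
    refine (map_ne_zero_iff φ Int.cast_injective).2 (mul_ne_zero hf0 (pow_ne_zero _ ?_))
    rw [leadingCoeff_ne_zero]
    intro h
    have := natDegree_polyIter f i
    rw [h, natDegree_zero] at this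
    exact (pow_pos (by omega) i).ne this
  obtain ⟨K, hK⟩ := finite_setOf_forall_eval_eq_mul_sq (ratPlaces a) (sIntegers a)
    (fun z hz hz0 => one_le_prod_ratPlaces ha hz hz0) (finite_sIntegers_le ha) hG hl hl0
    (fun i j hij => not_isSquare_mul_polyIter_of_dynIrred hdeg hinf (by omega) (by omega))
    ((Finset.Icc (-|M|) |M|).image (Int.cast : ℤ → ℚ)) (by
      intro c hc
      obtain ⟨c, -, rfl⟩ := Finset.mem_image.1 hc
      exact intCast_mem _ c)
  have hfin := hK.preimage (injective_aeval_polyIter hγ).injOn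
  obtain ⟨N, hN⟩ := hfin.bddAbove
  refine ⟨K, N + 1, fun n hn => ?_⟩
  by_contra! hcon
  refine absurd (hN (a := n) ⟨?_, fun i hi => ?_⟩) (by omega)
  · exact aeval_mem_sIntegers (by simpa [hγdef] using div_pow_mem_sIntegers ha (-b) 1) _
  · obtain ⟨c, y, hc, hcy⟩ := exists_eq_mul_sq_of_even_padicValInt (E := critValue f a b (n + (i + 1)))
      hM (fun p hp hpM => Nat.not_odd_iff_even.1 (hcon i hi p hp hpM))
    refine ⟨c, Finset.mem_image_of_mem _ (Finset.mem_Icc.2 (abs_le.1 hc)),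
      y / (a : ℚ) ^ (e * f.natDegree ^ (n + i)), div_pow_mem_sIntegers ha _ _, ?_⟩
    have h1 := map_critValue φ f b haQ (n + (i + 1))
    rw [show n + (i + 1) = (i + 1) + n by ring, eval_polyIter_add,
      show f.natDegree ^ (i + 1 + n) = e * f.natDegree ^ (n + i) + e * f.natDegree ^ (n + i) by
        rw [show i + 1 + n = n + i + 1 by ring, pow_succ]; nth_rw 2 [he]; ring,
      show i + 1 + n = n + (i + 1) by ring, hcy] at h1
    simp only [Polynomial.map_mul, map_C, map_polyIter, eval_mul, eval_C, aeval_polyIter_rat]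
    have haQ' : (a : ℚ) ≠ 0 := haQ
    simp only [map_mul, map_pow, hφ, eq_intCast, pow_add] at h1 ⊢
    have := pow_ne_zero (e * f.natDegree ^ (n + i)) haQ'
    rw [← hγdef] at h1
    generalize (f.leadingCoeff : ℚ) * _ = z at h1 ⊢
    field_simp
    linear_combination -h1

end Windows

theorem DirichletCharacter.norm_sum_range_le {q : ℕ} [NeZero q] {χ : DirichletCharacter ℂ q}
    (hχ : χ ≠ 1) (n : ℕ) : ‖∑ k ∈ Finset.range n, χ (k : ZMod q)‖ ≤ q := by
  have hperiod : ∑ k ∈ Finset.range q, χ (k : ZMod q) = 0 := by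
    rw [← MulChar.sum_eq_zero_of_ne_one hχ]
    obtain ⟨m, rfl⟩ := Nat.exists_eq_succ_of_ne_zero (NeZero.ne q)
    rw [← Fin.sum_univ_eq_sum_range (fun k => χ (k : ZMod (m + 1)))]
    exact Finset.sum_congr rfl fun i _ => congrArg χ (ZMod.natCast_zmod_val (n := m + 1) i)
  induction n using Nat.strong_induction_on with
  | _ n ih =>
    by_cases hn : n < q
    · calc ‖∑ k ∈ Finset.range n, χ (k : ZMod q)‖
          ≤ ∑ k ∈ Finset.range n, (1 : ℝ) :=
            norm_sum_le_of_le _ fun k _ => DirichletCharacter.norm_le_one χ _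
        _ ≤ q := by simpa using hn.le
    · obtain ⟨m, rfl⟩ := Nat.exists_eq_add_of_le (not_lt.1 hn)
      rw [Finset.sum_range_add, hperiod, zero_add]
      simpa using ih m (by have := NeZero.pos q; omega)

theorem DirichletCharacter.norm_sum_Icc_le {q : ℕ} [NeZero q] {χ : DirichletCharacter ℂ q}
    (hχ : χ ≠ 1) (n : ℕ) : ‖∑ k ∈ Finset.Icc 1 n, χ (k : ZMod q)‖ ≤ q := by
  have hq : Nontrivial (ZMod q) := by
    by_contra h
    rw [not_nontrivial_iff_subsingleton] at h
    exact hχ (MulChar.ext fun a => by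
      rw [Subsingleton.elim (a : ZMod q) 1]; simp)
  have h := norm_sum_range_le hχ (n + 1)
  rw [Finset.range_eq_Ico, Finset.sum_eq_sum_Ico_succ_bot (by omega)] at h
  simpa [MulChar.map_zero, Finset.Ico_add_one_right_eq_Icc] using h

open MeasureTheory Set in
theorem DirichletCharacter.norm_LFunction_le {q : ℕ} [NeZero q] {χ : DirichletCharacter ℂ q}
    (hχ : χ ≠ 1) {s : ℂ} (hs : 0 < s.re) :
    ‖DirichletCharacter.LFunction χ s‖ ≤ ‖s‖ * (q / s.re) := by
  set S : ℝ → ℂ := fun t => ∑ k ∈ Finset.Icc 1 ⌊t⌋₊, χ (k : ZMod q) with hS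
  have hSb : ∀ t, ‖S t‖ ≤ q := fun t => norm_sum_Icc_le hχ _
  have hS0 : ∀ t, t < 1 → S t = 0 := fun t ht => by
    simp [hS, Nat.floor_eq_zero.2 ht]
  have hSmeas : Measurable S :=
    (measurable_from_nat (f := fun n : ℕ => ∑ k ∈ Finset.Icc 1 n, χ (k : ZMod q))).comp
      Nat.measurable_floor
  have hSloc : LocallyIntegrableOn S (Ioi 0) := by
    apply LocallyIntegrable.locallyIntegrableOn
    exact (locallyIntegrable_const (q : ℝ)).mono hSmeas.aestronglyMeasurable
      (Filter.Eventually.of_forall fun t => by simpa using hSb t)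
  have hmell : ∀ z : ℂ, 0 < z.re → DifferentiableAt ℂ (fun w => w * mellin S (-w)) z := by
    intro z hz
    refine differentiableAt_id.mul ?_
    have h : DifferentiableAt ℂ (mellin S) (-z) := by
      refine mellin_differentiableAt_of_isBigO_rpow (a := 0) (b := -z.re - 1) hSloc ?_ (by simpa) ?_
        (by simp)
      · refine Asymptotics.IsBigO.of_bound q (Filter.Eventually.of_forall fun t => ?_)
        simpa using hSb t
      · refine Asymptotics.IsBigO.of_bound 0 ?_
        filter_upwards [mem_nhdsWithin_of_mem_nhds (Iio_mem_nhds (zero_lt_one (α := ℝ)))] with t ht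
        simp [hS0 t ht]
    exact h.comp z differentiableAt_id.neg
  have hIoi : ∀ z : ℂ, mellin S (-z) = ∫ t in Ioi (1 : ℝ), S t * t ^ (-(z + 1)) := by
    intro z
    rw [mellin, setIntegral_eq_of_subset_of_ae_sdiff_eq_zero (s := Ici 1) (t := Ioi 0)
      measurableSet_Ioi.nullMeasurableSet (fun t ht => lt_of_lt_of_le one_pos ht) ?_,
      integral_Ici_eq_integral_Ioi]
    · refine integral_congr_ae (Filter.Eventually.of_forall fun t => ?_)
      simp only [smul_eq_mul]
      rw [mul_comm, neg_add, sub_eq_add_neg]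
    · refine Filter.Eventually.of_forall fun t ht => ?_
      rw [hS0 t (by simpa using ht.2), smul_zero]
  have heq : ∀ z : ℂ, 1 < z.re → LFunction χ z = z * mellin S (-z) := by
    intro z hz
    rw [hIoi, LFunction_eq_LSeries χ hz]
    refine LSeries_eq_mul_integral _ le_rfl (by linarith) (LSeriesSummable_of_one_lt_re χ hz) ?_
    refine Asymptotics.IsBigO.of_bound q (Filter.Eventually.of_forall fun n => ?_)
    simpa using norm_sum_Icc_le hχ n
  have hopen : IsOpen {z : ℂ | 0 < z.re} := isOpen_lt continuous_const Complex.continuous_re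
  have heq' : LFunction χ s = s * mellin S (-s) := by
    refine AnalyticOnNhd.eqOn_of_preconnected_of_eventuallyEq (z₀ := 2) (U := {z : ℂ | 0 < z.re})
      (g := fun w => w * mellin S (-w))
      ((differentiable_LFunction hχ).differentiableOn.analyticOnNhd hopen)
      (DifferentiableOn.analyticOnNhd (fun z hz => (hmell z hz).differentiableWithinAt) hopen)
      (convex_halfSpace_re_gt 0).isPreconnected (by simp) ?_ hs
    filter_upwards [(isOpen_lt continuous_const Complex.continuous_re).mem_nhds
      (show (1 : ℝ) < (2 : ℂ).re by simp)] with z hz using heq z hz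
  rw [heq', norm_mul]
  refine mul_le_mul_of_nonneg_left ?_ (norm_nonneg _)
  rw [hIoi]
  have hint : IntegrableOn (fun t : ℝ => (q : ℝ) * t ^ (-(s.re + 1))) (Ioi 1) :=
    (integrableOn_Ioi_rpow_of_lt (by linarith) one_pos).const_mul _
  refine (norm_integral_le_of_norm_le hint ?_).trans_eq ?_
  · filter_upwards [ae_restrict_mem measurableSet_Ioi] with t ht
    rw [norm_mul, Complex.norm_cpow_eq_rpow_re_of_pos (one_pos.trans ht)]
    simp only [Complex.neg_re, Complex.add_re, Complex.one_re]
    exact mul_le_mul_of_nonneg_right (hSb t) (Real.rpow_nonneg (one_pos.trans ht).le _)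
  · rw [integral_const_mul, integral_Ioi_rpow_of_lt (by linarith) one_pos]
    have : s.re ≠ 0 := hs.ne'
    simp
    field_simp

open LSeries.notation in
theorem DirichletCharacter.half_le_norm_LFunction_two {q : ℕ} [NeZero q]
    (χ : DirichletCharacter ℂ q) : 1 / 2 ≤ ‖DirichletCharacter.LFunction χ 2‖ := by
  have h2 : (1 : ℝ) < (2 : ℂ).re := by simp
  have hmul := LSeries.mul_mu_eq_one χ h2
  rw [← LFunction_eq_LSeries χ h2] at hmul
  have hbound : ‖LSeries (↗χ * fun n => (ArithmeticFunction.moebius n : ℂ)) 2‖ ≤ 2 := by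
    have hterm : ∀ n, ‖LSeries.term (↗χ * fun n => (ArithmeticFunction.moebius n : ℂ)) 2 n‖
        ≤ 1 / (n : ℝ) ^ 2 := by
      intro n
      rcases eq_or_ne n 0 with rfl | hn
      · simp
      rw [LSeries.term_of_ne_zero hn, norm_div, Complex.norm_natCast_cpow_of_pos (by omega)]
      simp only [Pi.mul_apply, norm_mul, Complex.re_ofNat, Real.rpow_ofNat]
      gcongr
      have h1 := DirichletCharacter.norm_le_one χ (n : ZMod q)
      have h3 : ‖(ArithmeticFunction.moebius n : ℂ)‖ ≤ 1 := by
        rw [Complex.norm_intCast]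
        exact_mod_cast ArithmeticFunction.abs_moebius_le_one
      nlinarith [norm_nonneg (χ (n : ZMod q))]
    have hz := hasSum_zeta_two
    refine (tsum_of_norm_bounded hz hterm).trans ?_
    have h1 := Real.pi_lt_d2
    have h3 := Real.pi_pos
    nlinarith
  have h1 := congrArg norm hmul
  rw [norm_mul, norm_one] at h1
  nlinarith [norm_nonneg (LFunction χ 2)]

open Complex Metric in
theorem DirichletCharacter.norm_iteratedDeriv_logDeriv_LFunction_le {q : ℕ} [NeZero q]
    {χ : DirichletCharacter ℂ q} (hχ : χ ≠ 1)
    (hL : ∀ s : ℂ, 0 < s.re → s.re < 1 → LFunction χ s = 0 → s.re = 1 / 2) (k : ℕ) :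
    ‖iteratedDeriv k (fun s => deriv (LFunction χ) s / LFunction χ s) 2‖ ≤
      (k + 1).factorial * (10 * Real.log (14 * q)) / (5 / 4) ^ (k + 1) := by
  have hq : (1 : ℝ) ≤ q := by exact_mod_cast NeZero.one_le
  have hre : ∀ z ∈ ball (0 : ℂ) (3 / 2), 1 / 2 < (2 + z).re := by
    intro z hz
    have h1 := abs_le.1 (abs_re_le_norm z)
    rw [mem_ball_zero_iff] at hz
    simp only [add_re, re_ofNat]
    linarith [h1.1]
  have hne : ∀ z ∈ ball (0 : ℂ) (3 / 2), LFunction χ (2 + z) ≠ 0 := by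
    intro z hz h0
    have h1 := hre z hz
    by_cases h2 : (2 + z).re < 1
    · have := hL _ (by linarith) h2 h0
      linarith
    · exact LFunction_ne_zero_of_one_le_re χ (Or.inl hχ) (not_lt.1 h2) h0
  have hdiff : Differentiable ℂ (fun z => LFunction χ (2 + z)) :=
    (differentiable_LFunction hχ).comp (by fun_prop)
  have hd : ∀ z, HasDerivAt (fun z => LFunction χ (2 + z)) (deriv (LFunction χ) (2 + z)) z := by
    intro z
    simpa using (differentiable_LFunction hχ (2 + z)).hasDerivAt.comp_const_add 2 z
  have hd' : Differentiable ℂ (deriv (LFunction χ)) :=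
    fun z => ((differentiable_LFunction hχ).contDiff.differentiable_deriv_two (𝕜 := ℂ)) z
  set F : ℂ → ℂ := fun z => deriv (LFunction χ) (2 + z) / LFunction χ (2 + z) with hF
  have hFd : DifferentiableOn ℂ F (ball 0 (3 / 2)) := fun z hz =>
    ((hd'.comp (by fun_prop : Differentiable ℂ fun z : ℂ => 2 + z)) z).differentiableWithinAt.div
      (hdiff z).differentiableWithinAt (hne z hz)
  obtain ⟨h, h0, hh⟩ := hFd.isExactOn_ball.with_val_at 0 0
  have hhd : DifferentiableOn ℂ h (ball 0 (3 / 2)) :=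
    fun z hz => (hh z hz).differentiableAt.differentiableWithinAt
  have hexp : ∀ z ∈ ball (0 : ℂ) (3 / 2),
      LFunction χ (2 + z) = LFunction χ 2 * exp (h z) := by
    have hconst : ∀ z ∈ ball (0 : ℂ) (3 / 2),
        LFunction χ (2 + z) * exp (-h z) = LFunction χ 2 := by
      intro z hz
      have hder : ∀ w ∈ ball (0 : ℂ) (3 / 2),
          HasDerivAt (fun z => LFunction χ (2 + z) * exp (-h z)) 0 w := by
        intro w hw
        have := (hd w).mul (hh w hw).neg.cexp
        have h0 : deriv (LFunction χ) (2 + w) * exp (-h w) +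
            LFunction χ (2 + w) * (exp (-h w) * -F w) = 0 := by
          have := hne w hw
          simp only [hF]
          field_simp
          ring
        exact this.congr_deriv h0
      have := (convex_ball (0 : ℂ) (3 / 2)).is_const_of_fderivWithin_eq_zero (𝕜 := ℂ)
        (f := fun z => LFunction χ (2 + z) * exp (-h z))
        (fun w hw => (hder w hw).differentiableAt.differentiableWithinAt)
        (fun w hw => by
          rw [fderivWithin_of_isOpen isOpen_ball hw]
          simpa using (hder w hw).hasFDerivAt.fderiv) hz (mem_ball_self (by norm_num))
      simpa [h0] using this
    intro z hz
    rw [← hconst z hz, mul_assoc, ← exp_add]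
    simp
  have hM : 0 < Real.log (14 * q) := Real.log_pos (by linarith)
  have hmaps : Set.MapsTo h (ball 0 (3 / 2)) {z | z.re ≤ Real.log (14 * q)} := by
    intro z hz
    have h1 := hre z hz
    have h2 := norm_LFunction_le hχ (s := 2 + z) (by linarith)
    have h3 : ‖2 + z‖ ≤ 7 / 2 := by
      rw [mem_ball_zero_iff] at hz
      refine (norm_add_le _ _).trans ?_
      rw [Complex.norm_ofNat]; linarith
    have h4 := half_le_norm_LFunction_two χ
    have h5 : (q : ℝ) / (2 + z).re ≤ 2 * q := by
      rw [div_le_iff₀ (by linarith)]; nlinarith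
    rw [hexp z hz, norm_mul, norm_exp] at h2
    have h6 : ‖2 + z‖ * (q / (2 + z).re) ≤ 7 / 2 * (2 * q) := by
      have : 0 ≤ (q : ℝ) / (2 + z).re := div_nonneg (by linarith) (by linarith)
      gcongr
    change (h z).re ≤ _
    rw [Real.le_log_iff_exp_le (by linarith)]
    nlinarith [Real.exp_pos (h z).re]
  have hcauchy : ‖iteratedDeriv (k + 1) h 0‖ ≤
      (k + 1).factorial * (10 * Real.log (14 * q)) / (5 / 4) ^ (k + 1) := by
    refine norm_iteratedDeriv_le_of_forall_mem_sphere_norm_le _ (by norm_num) ?_ ?_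
    · exact (hhd.mono (closedBall_subset_ball (by norm_num))).diffContOnCl_ball
        (U := closedBall 0 (5 / 4)) subset_rfl
    · intro z hz
      rw [mem_sphere_zero_iff_norm] at hz
      refine (borelCaratheodory_zero hM hhd hmaps (by norm_num)
        (by rw [mem_ball_zero_iff, hz]; norm_num) h0).trans_eq ?_
      rw [hz]; ring
  have heq : iteratedDeriv (k + 1) h 0 =
      iteratedDeriv k (fun s => deriv (LFunction χ) s / LFunction χ s) 2 := by
    rw [iteratedDeriv_succ']
    have h1 : deriv h =ᶠ[nhds 0] F := by
      filter_upwards [isOpen_ball.mem_nhds (mem_ball_self (by norm_num : (0 : ℝ) < 3 / 2))]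
        with z hz using (hh z hz).deriv
    rw [Filter.EventuallyEq.iteratedDeriv_eq k h1]
    have := iteratedDeriv_comp_const_add k
      (fun s => deriv (LFunction χ) s / LFunction χ s) 2
    simp only [hF]
    rw [this]; simp
  rwa [← heq]

open ArithmeticFunction in
theorem DirichletCharacter.norm_tsum_vonMangoldt_mul_log_pow_le {q : ℕ} [NeZero q]
    {χ : DirichletCharacter ℂ q} (hχ : χ ≠ 1)
    (hL : ∀ s : ℂ, 0 < s.re → s.re < 1 → LFunction χ s = 0 → s.re = 1 / 2) (k : ℕ) :
    ‖∑' n : ℕ, χ (n : ZMod q) * ((Λ n * Real.log n ^ k / (n : ℝ) ^ 2 : ℝ) : ℂ)‖ ≤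
      (k + 1).factorial * (10 * Real.log (14 * q)) / (5 / 4) ^ (k + 1) := by
  have h2 : (1 : ℝ) < (2 : ℂ).re := by simp
  refine le_of_eq_of_le ?_ (norm_iteratedDeriv_logDeriv_LFunction_le hχ hL k)
  set f : ℕ → ℂ := (fun n : ℕ => χ (n : ZMod q)) * fun n : ℕ => ((Λ n : ℝ) : ℂ) with hf
  have hev : (fun s => deriv (LFunction χ) s / LFunction χ s) =ᶠ[nhds 2]
      fun s => - LSeries f s := by
    filter_upwards [(isOpen_lt continuous_const Complex.continuous_re).mem_nhds h2] with s hs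
    rw [hf, LSeries_twist_vonMangoldt_eq χ hs, deriv_LFunction_eq_deriv_LSeries χ hs,
      LFunction_eq_LSeries χ hs]
    ring
  have habs : LSeries.abscissaOfAbsConv f < ((2 : ℂ).re : EReal) := by
    refine lt_of_le_of_lt (LSeries.abscissaOfAbsConv_le_of_forall_lt_LSeriesSummable (x := 1)
      fun y hy => ?_) (by exact_mod_cast h2)
    exact LSeriesSummable_twist_vonMangoldt χ (by simpa using hy)
  rw [Filter.EventuallyEq.iteratedDeriv_eq k hev, iteratedDeriv_fun_neg, norm_neg,
    LSeries_iteratedDeriv k habs, norm_mul, norm_pow, norm_neg, norm_one, one_pow, one_mul]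
  congr 1
  refine tsum_congr fun n => ?_
  have hlog : ∀ (k : ℕ) (g : ℕ → ℂ), LSeries.logMul^[k] g n = Complex.log n ^ k * g n := by
    intro k
    induction k with
    | zero => simp
    | succ k ih => intro g; rw [Function.iterate_succ_apply, ih, LSeries.logMul]; ring
  rcases eq_or_ne n 0 with rfl | hn
  · simp
  rw [LSeries.term_of_ne_zero hn, hlog, hf, Pi.mul_apply]
  push_cast
  rw [Complex.cpow_ofNat]
  ring

open NumberTheorySymbols in
theorem exists_dirichletCharacter_eq_jacobiSym {E : ℤ} (hE : E ≠ 0) :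
    ∃ χ : DirichletCharacter ℂ (4 * E.natAbs),
      ∀ n : ℕ, χ (n : ZMod (4 * E.natAbs)) = if Odd n then (J(E | n) : ℂ) else 0 := by
  set q := 4 * E.natAbs with hq
  have hq0 : NeZero q := ⟨by have := Int.natAbs_pos.2 hE; omega⟩
  have hqe : Even q := ⟨2 * E.natAbs, by omega⟩
  have hq1 : 1 < q := by have := Int.natAbs_pos.2 hE; omega
  have : Fact (1 < q) := ⟨hq1⟩
  have hodd : ∀ n : ℕ, Odd (n % q) ↔ Odd n := fun n => by
    rw [Nat.odd_iff, Nat.odd_iff, Nat.mod_mod_of_dvd n hqe.two_dvd]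
  have hper : ∀ n : ℕ, Odd n → J(E | n % q) = J(E | n) := fun n hn =>
    (jacobiSym.mod_right E hn).symm
  set F : ℕ → ℂ := fun n => if Odd n then (J(E | n) : ℂ) else 0 with hF
  have hFper : ∀ n, F (n % q) = F n := by
    intro n
    simp only [hF, hodd]
    split_ifs with h
    · rw [hper n h]
    · rfl
  have hFmul : ∀ m n, F (m * n) = F m * F n := by
    intro m n
    simp only [hF, Nat.odd_mul]
    by_cases hm : Odd m <;> by_cases hn : Odd n <;> simp only [hm, hn, and_true, and_false,
      if_true, if_false, mul_zero, zero_mul]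
    have : NeZero m := ⟨hm.pos.ne'⟩
    have : NeZero n := ⟨hn.pos.ne'⟩
    rw [jacobiSym.mul_right]; push_cast; rfl
  refine ⟨{ toFun := fun z => F z.val, map_one' := ?_, map_mul' := ?_, map_nonunit' := ?_ }, ?_⟩
  · simp [ZMod.val_one, hF]
  · intro x y
    rw [ZMod.val_mul, hFper, hFmul]
  · intro z hz
    by_contra h
    apply hz
    have hzo : Odd z.val := by
      by_contra h'
      simp [hF, h'] at h
    have hJ : J(E | z.val) ≠ 0 := fun h' => h (by simp [hF, h'])
    have : NeZero z.val := ⟨hzo.pos.ne'⟩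
    have hg : E.gcd z.val = 1 := by
      by_contra h'
      exact hJ (jacobiSym.eq_zero_iff_not_coprime.2 h')
    rw [← ZMod.natCast_zmod_val z, ZMod.isUnit_iff_coprime]
    refine Nat.coprime_mul_iff_right.2 ?_
    refine ⟨?_, ?_⟩
    · rw [show 4 = 2 ^ 2 from rfl]
      exact Nat.Coprime.pow_right _ (Nat.coprime_two_right.2 hzo)
    · rw [Int.gcd_eq_natAbs, Int.natAbs_natCast] at hg
      exact Nat.Coprime.symm hg
  · intro n
    change F (n : ZMod q).val = _
    rw [ZMod.val_natCast, hFper]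

open NumberTheorySymbols in
theorem exists_jacobiSym_eq_neg_one {E : ℤ} {p : ℕ} (hp : p.Prime) (hp2 : p ≠ 2)
    (hE : E ≠ 0) (hv : Odd (padicValInt p E)) : ∃ n : ℕ, Odd n ∧ J(E | n) = -1 := by
  have : Fact p.Prime := ⟨hp⟩
  have hfin : FiniteMultiplicity (p : ℤ) E := by
    rw [Int.finiteMultiplicity_iff]
    exact ⟨by simpa using hp.ne_one, hE⟩
  obtain ⟨D, hED, hpD⟩ := hfin.exists_eq_pow_mul_and_not_dvd
  rw [padicValInt.of_ne_one_ne_zero hp.ne_one hE] at hv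
  have hpodd : Odd p := hp.odd_of_ne_two hp2
  have hco : Nat.Coprime (4 * D.natAbs) p := by
    rw [Nat.coprime_comm, Nat.coprime_mul_iff_right]
    refine ⟨?_, ?_⟩
    · rw [show 4 = 2 ^ 2 from rfl]
      exact Nat.Coprime.pow_right _ (Nat.coprime_two_right.2 hpodd)
    · rw [hp.coprime_iff_not_dvd]
      exact fun h => hpD (Int.natCast_dvd.2 h)
  obtain ⟨y, hy⟩ := FiniteField.exists_nonsquare (F := ZMod p) (by rwa [ZMod.ringChar_zmod_n])
  obtain ⟨n, hn1, hn2⟩ := Nat.chineseRemainder hco 1 y.val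
  have hn4 : n % 4 = 1 := by
    have := hn1.of_mul_right D.natAbs
    exact this
  have hnodd : Odd n := by rw [Nat.odd_iff]; omega
  refine ⟨n, hnodd, ?_⟩
  have h1 : J(D | n) = 1 := by
    rw [jacobiSym.mod_right D hnodd, show n % (4 * D.natAbs) = 1 % (4 * D.natAbs) from hn1,
      ← jacobiSym.mod_right D odd_one, jacobiSym.one_right]
  have h2 : J(p | n) = -1 := by
    rw [jacobiSym.quadratic_reciprocity_one_mod_four' hpodd hn4]
    rw [← jacobiSym.legendreSym.to_jacobiSym, legendreSym.eq_neg_one_iff]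
    have : (((n : ℕ) : ℤ) : ZMod p) = y := by
      rw [Int.cast_natCast, (ZMod.natCast_eq_natCast_iff _ _ _).2 hn2, ZMod.natCast_zmod_val]
    rwa [this]
  rw [hED, jacobiSym.mul_left, jacobiSym.pow_left, h1, h2, hv.neg_one_pow, mul_one]

section Sieve

open ArithmeticFunction

theorem factorial_le_mul_div_exp_pow {n : ℕ} (hn : n ≠ 0) :
    (n.factorial : ℝ) ≤ Real.exp 1 * n * (n / Real.exp 1) ^ n := by
  induction n with
  | zero => exact absurd rfl hn
  | succ n ih =>
    rcases Nat.eq_zero_or_pos n with rfl | hpos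
    · simp
    have hn' : (0 : ℝ) < n := by exact_mod_cast hpos
    have h1 : ((n : ℝ) / (n + 1)) ^ (n + 1) ≤ Real.exp (-1) := by
      calc ((n : ℝ) / (n + 1)) ^ (n + 1) ≤ Real.exp (-(1 / ((n : ℝ) + 1))) ^ (n + 1) := by
            gcongr
            refine le_trans (le_of_eq ?_) (Real.add_one_le_exp _)
            field_simp
            ring
        _ = Real.exp (-1) := by
            rw [← Real.exp_nat_mul]
            congr 1
            push_cast
            field_simp
    have h2 : (n : ℝ) * (n / Real.exp 1) ^ n ≤ ((n + 1 : ℝ) / Real.exp 1) ^ (n + 1) := by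
      calc (n : ℝ) * (n / Real.exp 1) ^ n
          = ((n : ℝ) / (n + 1)) ^ (n + 1) * (((n + 1 : ℝ) / Real.exp 1) ^ (n + 1) * Real.exp 1) := by
            rw [← mul_assoc, ← mul_pow,
              show (n : ℝ) / (n + 1) * ((n + 1) / Real.exp 1) = n / Real.exp 1 by field_simp, pow_succ]
            field_simp
        _ ≤ Real.exp (-1) * (((n + 1 : ℝ) / Real.exp 1) ^ (n + 1) * Real.exp 1) := by gcongr
        _ = ((n + 1 : ℝ) / Real.exp 1) ^ (n + 1) := by
            rw [mul_left_comm, ← Real.exp_add, neg_add_cancel, Real.exp_zero, mul_one]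
    rw [Nat.factorial_succ]
    push_cast
    calc ((n : ℝ) + 1) * n.factorial
        ≤ (n + 1) * (Real.exp 1 * n * (n / Real.exp 1) ^ n) := by gcongr; exact ih hpos.ne'
      _ = Real.exp 1 * (n + 1) * (n * (n / Real.exp 1) ^ n) := by ring
      _ ≤ _ := by gcongr

/-- The weight `Λ(m) (log m) ^ k / m ^ 2`. -/
noncomputable def sieveWeight (k m : ℕ) : ℝ := Λ m * Real.log m ^ k / (m : ℝ) ^ 2

theorem sieveWeight_nonneg (k m : ℕ) : 0 ≤ sieveWeight k m :=
  div_nonneg (mul_nonneg vonMangoldt_nonneg (pow_nonneg (Real.log_natCast_nonneg m) k))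
    (by positivity)

theorem sieveWeight_le (k m : ℕ) : sieveWeight k m ≤
    ((k + 1).factorial * Real.exp 1) * (1 / (m : ℝ) ^ (1 + 1 / ((k + 2 : ℕ) : ℝ))) := by
  rcases Nat.eq_zero_or_pos m with rfl | hm
  · rw [sieveWeight, Nat.cast_zero, Real.log_zero, ArithmeticFunction.map_zero]
    simp only [zero_mul, zero_div]
    positivity
  have hm' : (0 : ℝ) < m := by exact_mod_cast hm
  have hlog := Real.log_natCast_nonneg m
  set x := Real.log m
  set j : ℕ := k + 1 with hj
  have hj0 : (0 : ℝ) < j := by rw [hj]; positivity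
  have hjk : ((k + 2 : ℕ) : ℝ) = j + 1 := by rw [hj]; push_cast; ring
  have h1 := Real.pow_div_factorial_le_exp (x * (j / (j + 1))) (by positivity) j
  have h2 : (1 + 1 / (j : ℝ)) ^ j ≤ Real.exp 1 := by
    calc (1 + 1 / (j : ℝ)) ^ j ≤ Real.exp (1 / (j : ℝ)) ^ j := by
          gcongr
          rw [add_comm]
          exact Real.add_one_le_exp _
      _ = Real.exp 1 := by rw [← Real.exp_nat_mul]; congr 1; field_simp
  have h3 : x ^ j ≤ j.factorial * Real.exp 1 * Real.exp (x * (j / (j + 1))) := by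
    calc x ^ j = (x * (j / (j + 1))) ^ j / j.factorial * (j.factorial * (1 + 1 / (j : ℝ)) ^ j) := by
          rw [mul_pow, show 1 + 1 / (j : ℝ) = ((j : ℝ) / (j + 1))⁻¹ by field_simp, inv_pow]
          field_simp
      _ ≤ Real.exp (x * (j / (j + 1))) * (j.factorial * Real.exp 1) := by gcongr
      _ = _ := by ring
  have h4 : Real.exp (x * (j / (j + 1))) / (m : ℝ) ^ 2 = 1 / (m : ℝ) ^ (1 + 1 / ((j : ℝ) + 1)) := by
    rw [← Real.rpow_natCast, Real.rpow_def_of_pos hm', Real.rpow_def_of_pos hm', ← Real.exp_sub,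
      one_div, ← Real.exp_neg]
    congr 1
    field_simp
    push_cast
    ring
  rw [sieveWeight, hjk, ← h4, ← mul_div_assoc]
  have h5 : Λ m * x ^ k ≤ x ^ j := by
    rw [hj, pow_succ']
    gcongr
    exact vonMangoldt_le_log
  exact div_le_div_of_nonneg_right (h5.trans h3) (by positivity)

theorem summable_sieveWeight (k : ℕ) : Summable (sieveWeight k) := by
  refine Summable.of_nonneg_of_le (sieveWeight_nonneg k) (sieveWeight_le k) (Summable.mul_left _ ?_)
  rw [Real.summable_one_div_nat_rpow]
  have : (0 : ℝ) < 1 / ((k + 2 : ℕ) : ℝ) := by positivity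
  linarith

theorem eventually_tsum_sieveWeight_le : ∀ᶠ k : ℕ in Filter.atTop,
    ∑' m, sieveWeight k m ≤ 6 * (k + 2) * (k + 1).factorial := by
  have htend : Filter.Tendsto (fun k : ℕ => 1 + 1 / ((k + 2 : ℕ) : ℝ)) Filter.atTop
      (nhdsWithin 1 (Set.Ioi 1)) := by
    refine tendsto_nhdsWithin_iff.2 ⟨?_, Filter.Eventually.of_forall fun k => ?_⟩
    · have h := (tendsto_const_nhds (x := (1 : ℝ))).add
        ((Filter.tendsto_add_atTop_iff_nat 2).2 (tendsto_one_div_atTop_nhds_zero_nat (𝕜 := ℝ)))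
      simpa using h
    · have : (0 : ℝ) < 1 / ((k + 2 : ℕ) : ℝ) := by positivity
      simpa using this
  have h := (tendsto_sub_mul_tsum_nat_rpow.comp htend).eventually_le_const one_lt_two
  filter_upwards [h] with k hk
  simp only [Function.comp_apply, add_sub_cancel_left] at hk
  set Z := ∑' n : ℕ, 1 / (n : ℝ) ^ (1 + 1 / ((k + 2 : ℕ) : ℝ)) with hZ
  have hk2 : (0 : ℝ) < ((k + 2 : ℕ) : ℝ) := by positivity
  have hZ2 : Z ≤ 2 * (k + 2) := by
    rw [one_div, inv_mul_le_iff₀ hk2] at hk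
    push_cast at hk
    linarith
  have hsum : Summable fun n : ℕ => 1 / (n : ℝ) ^ (1 + 1 / ((k + 2 : ℕ) : ℝ)) := by
    rw [Real.summable_one_div_nat_rpow]
    have : (0 : ℝ) < 1 / ((k + 2 : ℕ) : ℝ) := by positivity
    linarith
  calc ∑' m, sieveWeight k m ≤ ∑' m : ℕ, ((k + 1).factorial * Real.exp 1) *
        (1 / (m : ℝ) ^ (1 + 1 / ((k + 2 : ℕ) : ℝ))) :=
        (summable_sieveWeight k).tsum_le_tsum (sieveWeight_le k) (hsum.mul_left _)
    _ = ((k + 1).factorial * Real.exp 1) * Z := by rw [tsum_mul_left]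
    _ ≤ ((k + 1).factorial * 3) * (2 * (k + 2)) := by
        have := Real.exp_one_lt_three.le
        gcongr
    _ = 6 * (k + 2) * (k + 1).factorial := by ring

/-- The Jacobi symbol `J(E | m)` for odd `m`, extended by zero to even `m`. -/
noncomputable def oddJacobi (E : ℤ) (m : ℕ) : ℝ := if Odd m then (jacobiSym E m : ℝ) else 0

theorem abs_oddJacobi_le (E : ℤ) (m : ℕ) : |oddJacobi E m| ≤ 1 := by
  rw [oddJacobi]
  split_ifs
  · rcases jacobiSym.trichotomy E m with h | h | h <;> simp [h]
  · simp

theorem summable_sieveWeight_mul_oddJacobi (k : ℕ) (E : ℤ) :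
    Summable fun m => sieveWeight k m * oddJacobi E m := by
  refine Summable.of_norm_bounded (summable_sieveWeight k) fun m => ?_
  rw [norm_mul, Real.norm_of_nonneg (sieveWeight_nonneg k m)]
  exact mul_le_of_le_one_right (sieveWeight_nonneg k m) (abs_oddJacobi_le E m)

theorem abs_tsum_sieveWeight_mul_oddJacobi_le
    (hGRH : ∀ (q : ℕ) [NeZero q] (χ : DirichletCharacter ℂ q) (s : ℂ),
      0 < s.re → s.re < 1 → DirichletCharacter.LFunction χ s = 0 → s.re = 1 / 2)
    {E : ℤ} (hE : E ≠ 0) (hn : ∃ n, Odd n ∧ jacobiSym E n = -1) (k : ℕ) :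
    |∑' m, sieveWeight k m * oddJacobi E m| ≤
      (k + 1).factorial * (10 * Real.log (56 * |(E : ℝ)|)) / (5 / 4) ^ (k + 1) := by
  obtain ⟨χ, hχ⟩ := exists_dirichletCharacter_eq_jacobiSym hE
  have : NeZero (4 * E.natAbs) := ⟨by simpa using hE⟩
  have hχ1 : χ ≠ 1 := by
    rintro rfl
    obtain ⟨n, hodd, hn⟩ := hn
    have h1 := hχ n
    rw [if_pos hodd, hn] at h1
    by_cases hu : IsUnit (n : ZMod (4 * E.natAbs))
    · rw [MulChar.one_apply hu] at h1
      norm_num at h1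
    · rw [MulChar.map_nonunit _ hu] at h1
      norm_num at h1
  have h := DirichletCharacter.norm_tsum_vonMangoldt_mul_log_pow_le hχ1 (hGRH _ χ) k
  convert h using 1
  · rw [← Real.norm_eq_abs, ← Complex.norm_real, Complex.ofReal_tsum]
    congr 1
    refine tsum_congr fun m => ?_
    rw [hχ, sieveWeight, oddJacobi]
    split_ifs
    · push_cast; ring
    · simp
  · rw [show (56 : ℝ) * |(E : ℝ)| = 14 * ((4 * E.natAbs : ℕ) : ℝ) by
      rw [Nat.cast_mul, Nat.cast_natAbs]
      push_cast
      ring]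

theorem jacobiSym_prod {ι : Type*} (T : Finset ι) (E : ι → ℤ) (m : ℕ) :
    jacobiSym (∏ i ∈ T, E i) m = ∏ i ∈ T, jacobiSym (E i) m := by
  classical
  induction T using Finset.induction_on with
  | empty => simp
  | insert i T hi ih => rw [Finset.prod_insert hi, Finset.prod_insert hi, jacobiSym.mul_left, ih]

theorem two_pow_card_mul_card_le
    (hGRH : ∀ (q : ℕ) [NeZero q] (χ : DirichletCharacter ℂ q) (s : ℂ),
      0 < s.re → s.re < 1 → DirichletCharacter.LFunction χ s = 0 → s.re = 1 / 2)
    (s : Finset ℕ) (E : ℕ → ℤ) (hE : ∀ i ∈ s, E i ≠ 0)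
    (hp : ∀ i ∈ s, ∃ p : ℕ, p.Prime ∧ p ≠ 2 ∧ Odd (padicValInt p (E i)) ∧
      ∀ j ∈ s, (p : ℤ) ∣ E j → j = i)
    {P : Finset ℕ} {Q : ℕ} (hQ : 1 ≤ Q) (hP : ∀ p ∈ P, p.Prime ∧ p ≠ 2 ∧ Q ≤ p ∧ p ≤ 2 * Q)
    (hJ : ∀ p ∈ P, ∀ i ∈ s, jacobiSym (E i) p = -1) (k : ℕ) :
    2 ^ s.card * (P.card * (Real.log Q ^ (k + 1) / (4 * (Q : ℝ) ^ 2))) ≤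
      ∑' m, sieveWeight k m + 2 ^ s.card * ((k + 1).factorial *
        (10 * Real.log (56 * ∏ i ∈ s, |(E i : ℝ)|)) / (5 / 4) ^ (k + 1)) := by
  set F : ℕ → ℝ := fun m => sieveWeight k m * if Odd m then ∏ i ∈ s, (1 - (jacobiSym (E i) m : ℝ)) else 0
    with hF
  have hFeq : ∀ m, F m = ∑ T ∈ s.powerset, (-1) ^ T.card *
      (sieveWeight k m * oddJacobi (∏ i ∈ T, E i) m) := by
    intro m
    simp only [hF, oddJacobi]
    split_ifs with hm
    · simp only [sub_eq_add_neg]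
      rw [Finset.prod_one_add, Finset.mul_sum]
      refine Finset.sum_congr rfl fun T _ => ?_
      rw [Finset.prod_neg, jacobiSym_prod]
      push_cast
      ring
    · simp
  have hsum : ∀ T ∈ s.powerset, Summable fun m => (-1 : ℝ) ^ T.card *
      (sieveWeight k m * oddJacobi (∏ i ∈ T, E i) m) := fun T _ =>
    (summable_sieveWeight_mul_oddJacobi k _).mul_left _
  have hFsum : Summable F := by
    rw [funext hFeq]
    exact summable_sum hsum
  have hF0 : ∀ m, 0 ≤ F m := by
    intro m
    refine mul_nonneg (sieveWeight_nonneg k m) ?_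
    split_ifs
    · refine Finset.prod_nonneg fun i _ => ?_
      rcases jacobiSym.trichotomy (E i) m with h | h | h <;> simp [h]
    · exact le_rfl
  have hQ' : (1 : ℝ) ≤ Q := by exact_mod_cast hQ
  have hlow : 2 ^ s.card * (P.card * (Real.log Q ^ (k + 1) / (4 * (Q : ℝ) ^ 2))) ≤ ∑' m, F m := by
    refine le_trans ?_ (hFsum.sum_le_tsum P fun m _ => hF0 m)
    rw [mul_left_comm, ← nsmul_eq_mul]
    refine Finset.card_nsmul_le_sum _ _ _ fun p hpP => ?_
    obtain ⟨hpp, hp2, hQp, hpQ⟩ := hP p hpP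
    have hQp' : (Q : ℝ) ≤ p := by exact_mod_cast hQp
    have hpQ' : (p : ℝ) ≤ 2 * Q := by exact_mod_cast hpQ
    have hp0 : (0 : ℝ) < p := by linarith
    have h1 : ∏ i ∈ s, (1 - (jacobiSym (E i) p : ℝ)) = 2 ^ s.card := by
      rw [Finset.prod_congr rfl fun i hi => by rw [hJ p hpP i hi], Finset.prod_const]
      norm_num
    simp only [hF]
    rw [if_pos (hpp.odd_of_ne_two hp2), h1, mul_comm, sieveWeight, vonMangoldt_apply_prime hpp,
      ← pow_succ']
    gcongr
    · calc (p : ℝ) ^ 2 ≤ (2 * Q) ^ 2 := by gcongr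
        _ = 4 * (Q : ℝ) ^ 2 := by ring
  refine hlow.trans ?_
  have hW0 : 0 ≤ ∑' m, sieveWeight k m := tsum_nonneg (sieveWeight_nonneg k)
  set B := (k + 1).factorial *
        (10 * Real.log (56 * ∏ i ∈ s, |(E i : ℝ)|)) / (5 / 4) ^ (k + 1) with hB
  have hE1 : ∀ i ∈ s, 1 ≤ |(E i : ℝ)| := fun i hi => by
    exact_mod_cast Int.one_le_abs (hE i hi)
  have hterm : ∀ T ∈ s.powerset.erase ∅, |∑' m, sieveWeight k m * oddJacobi (∏ i ∈ T, E i) m| ≤ B := by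
    intro T hT
    rw [Finset.mem_erase, Finset.mem_powerset, ← Finset.nonempty_iff_ne_empty] at hT
    obtain ⟨⟨t, ht⟩, hTs⟩ := hT
    have hE0 : ∏ i ∈ T, E i ≠ 0 := Finset.prod_ne_zero_iff.2 fun i hi => hE i (hTs hi)
    obtain ⟨p, hpp, hp2, hodd, hpE⟩ := hp t (hTs ht)
    have : Fact p.Prime := ⟨hpp⟩
    have hval : padicValInt p (∏ i ∈ T, E i) = padicValInt p (E t) := by
      classical
      rw [← Finset.mul_prod_erase T E ht, padicValInt.mul (hE t (hTs ht))
        (Finset.prod_ne_zero_iff.2 fun i hi => hE i (hTs (Finset.mem_of_mem_erase hi))),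
        padicValInt.eq_zero_of_not_dvd (z := ∏ i ∈ T.erase t, E i), add_zero]
      intro hdvd
      obtain ⟨i, hi, hpi⟩ := (Nat.prime_iff_prime_int.1 hpp).exists_mem_finset_dvd hdvd
      exact (Finset.mem_erase.1 hi).1 (hpE i (hTs (Finset.mem_of_mem_erase hi)) hpi)
    refine (abs_tsum_sieveWeight_mul_oddJacobi_le hGRH hE0
      (exists_jacobiSym_eq_neg_one hpp hp2 hE0 (hval ▸ hodd)) k).trans ?_
    rw [hB, Int.cast_prod, Finset.abs_prod]
    have hpos : 0 < ∏ i ∈ T, |(E i : ℝ)| :=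
      Finset.prod_pos fun i hi => zero_lt_one.trans_le (hE1 i (hTs hi))
    have hle : ∏ i ∈ T, |(E i : ℝ)| ≤ ∏ i ∈ s, |(E i : ℝ)| :=
      Finset.prod_le_prod_of_subset_of_one_le hTs (fun i _ => abs_nonneg _) fun i hi _ => hE1 i hi
    gcongr
  have hB0 : 0 ≤ B := by
    have h1 : (1 : ℝ) ≤ ∏ i ∈ s, |(E i : ℝ)| := by
      simpa using Finset.prod_le_prod (s := s) (f := fun _ => (1 : ℝ)) (fun _ _ => zero_le_one) hE1
    have := Real.log_nonneg (x := 56 * ∏ i ∈ s, |(E i : ℝ)|) (by linarith)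
    positivity
  rw [tsum_congr hFeq, Summable.tsum_finsetSum hsum]
  simp only [tsum_mul_left]
  rw [← Finset.add_sum_erase _ _ (Finset.empty_mem_powerset s)]
  refine add_le_add ?_ ?_
  · simp only [Finset.card_empty, pow_zero, one_mul, Finset.prod_empty]
    refine (summable_sieveWeight_mul_oddJacobi k _).tsum_le_tsum (fun m => ?_)
      (summable_sieveWeight k)
    exact mul_le_of_le_one_right (sieveWeight_nonneg k m) ((le_abs_self _).trans (abs_oddJacobi_le _ m))
  · calc _ ≤ ∑ T ∈ s.powerset.erase ∅, B := Finset.sum_le_sum fun T hT => by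
          refine (le_abs_self _).trans ?_
          rw [abs_mul, abs_pow, abs_neg, abs_one, one_pow, one_mul]
          exact hterm T hT
      _ ≤ ∑ T ∈ s.powerset, B := Finset.sum_le_sum_of_subset_of_nonneg (Finset.erase_subset _ _)
          fun _ _ _ => hB0
      _ = 2 ^ s.card * B := by rw [Finset.sum_const, Finset.card_powerset, nsmul_eq_mul]; push_cast; rfl

end Sieve

section Growth

theorem exists_abs_critValue_le {f : ℤ[X]} (hdeg : 2 ≤ f.natDegree) {a : ℤ} (b : ℤ) (ha : a ≠ 0) :
    ∃ B : ℝ, 1 ≤ B ∧ ∀ n, |(critValue f a b n : ℝ)| ≤ B ^ f.natDegree ^ n := by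
  set φ := Int.castRingHom ℝ with hφ
  set F := f.map φ with hF
  set γ : ℝ := -φ b / φ a with hγ
  have hFdeg : F.natDegree = f.natDegree := natDegree_map_eq_of_injective Int.cast_injective f
  set S : ℝ := 1 + ∑ i ∈ Finset.range (F.natDegree + 1), |F.coeff i| with hS
  have hS1 : 1 ≤ S := le_add_of_nonneg_right (Finset.sum_nonneg fun _ _ => abs_nonneg _)
  have heval : ∀ x m : ℝ, 1 ≤ m → |x| ≤ m → |F.eval x| ≤ S * m ^ f.natDegree := by
    intro x m hm hx
    rw [eval_eq_sum_range]
    calc |∑ i ∈ Finset.range (F.natDegree + 1), F.coeff i * x ^ i|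
        ≤ ∑ i ∈ Finset.range (F.natDegree + 1), |F.coeff i| * m ^ f.natDegree := by
          refine (Finset.abs_sum_le_sum_abs _ _).trans (Finset.sum_le_sum fun i hi => ?_)
          rw [abs_mul, abs_pow]
          refine mul_le_mul_of_nonneg_left ?_ (abs_nonneg _)
          have hi' : i ≤ f.natDegree := by rw [← hFdeg]; exact Finset.mem_range_succ_iff.1 hi
          exact (pow_le_pow_left₀ (abs_nonneg x) hx i).trans (pow_le_pow_right₀ hm hi')
      _ = (∑ i ∈ Finset.range (F.natDegree + 1), |F.coeff i|) * m ^ f.natDegree := by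
          rw [Finset.sum_mul]
      _ ≤ S * m ^ f.natDegree := by
          gcongr
          rw [hS]; linarith
  set B := S * max 1 |γ| with hB
  have hB1 : 1 ≤ B := one_le_mul_of_one_le_of_one_le hS1 (le_max_left _ _)
  have horbit : ∀ n, S * max 1 |(polyIter F n).eval γ| ≤ B ^ f.natDegree ^ n := by
    intro n
    induction n with
    | zero => simp [polyIter_zero, hB]
    | succ n ih =>
      have hS0 : 0 < S := by linarith
      set m := max 1 |(polyIter F n).eval γ| with hmdef
      have hm : 1 ≤ m := le_max_left _ _
      rw [eval_polyIter_succ]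
      calc S * max 1 |F.eval ((polyIter F n).eval γ)| ≤ S * (S * m ^ f.natDegree) := by
            gcongr
            exact max_le (one_le_mul_of_one_le_of_one_le hS1 (one_le_pow₀ hm))
              (heval _ m hm (le_max_right _ _))
        _ = S ^ 2 * m ^ f.natDegree := by ring
        _ ≤ S ^ f.natDegree * m ^ f.natDegree := by gcongr
        _ = (S * m) ^ f.natDegree := (mul_pow _ _ _).symm
        _ ≤ (B ^ f.natDegree ^ n) ^ f.natDegree := by gcongr
        _ = B ^ f.natDegree ^ (n + 1) := by rw [← pow_mul, pow_succ]
  refine ⟨max 1 (|(f.leadingCoeff : ℝ)| * |(a : ℝ)| * B), le_max_left _ _, fun n => ?_⟩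
  have haR : φ a ≠ 0 := by simpa [hφ] using ha
  have h1 := map_critValue φ f b haR n
  have hf1 : 1 ≤ |(f.leadingCoeff : ℝ)| := by
    have : f.leadingCoeff ≠ 0 := by rw [leadingCoeff_ne_zero]; rintro rfl; simp at hdeg
    exact_mod_cast Int.one_le_abs this
  rw [hφ, eq_intCast] at h1
  rw [h1, ← hφ]
  have hn0 : f.natDegree ^ n ≠ 0 := pow_ne_zero _ (by omega)
  calc |φ a ^ f.natDegree ^ n * (φ f.leadingCoeff * (polyIter F n).eval γ)|
      = |(f.leadingCoeff : ℝ)| * |(a : ℝ)| ^ f.natDegree ^ n * |(polyIter F n).eval γ| := by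
        rw [abs_mul, abs_mul, abs_pow]
        simp only [hφ, eq_intCast]
        ring
    _ ≤ |(f.leadingCoeff : ℝ)| ^ f.natDegree ^ n * |(a : ℝ)| ^ f.natDegree ^ n *
          B ^ f.natDegree ^ n := by
        gcongr
        · exact le_self_pow₀ hf1 hn0
        · exact (le_max_right 1 _).trans ((le_mul_of_one_le_left (by positivity) hS1).trans (horbit n))
    _ = (|(f.leadingCoeff : ℝ)| * |(a : ℝ)| * B) ^ f.natDegree ^ n := by simp only [mul_pow]
    _ ≤ _ := by gcongr; exact le_max_right _ _

end Growth

section Frequency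

theorem clog_error_eventually_le (A c : ℝ) (hA : 0 ≤ A) (hc : 0 ≤ c) (d N K : ℕ) :
    ∀ᶠ j : ℕ in Filter.atTop, (A + (4 * Nat.clog 2 (j + 1) : ℕ) *
      (c * (d : ℝ) ^ (N + 4 * Nat.clog 2 (j + 1) * K))) * ((4 / 5) ^ j * ((j : ℝ) + 1) ^ 3) ≤ 1 := by
  set e := 1 + 4 * d * K with he
  set A' := A + 4 * c * (d : ℝ) ^ N * 2 ^ (4 * d * K) with hA'
  have htend := ((Filter.tendsto_add_atTop_iff_nat 1).2 (tendsto_pow_const_mul_const_pow_of_abs_lt_one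
    (e + 3) (r := (4 / 5 : ℝ)) (by rw [abs_of_pos] <;> norm_num))).const_mul (A' * (5 / 4))
  rw [mul_zero] at htend
  filter_upwards [htend.eventually_le_const one_pos, Filter.eventually_ge_atTop 1] with j hj hj1
  push_cast at hj
  set t := Nat.clog 2 (j + 1) with ht
  set q : ℝ := (j : ℝ) + 1 with hq
  have hq1 : 1 ≤ q := by rw [hq]; simp
  have ht1 : (t : ℝ) ≤ q := by
    have h : t ≤ j + 1 := Nat.clog_le_of_le_pow (Nat.lt_two_pow_self).le
    rw [hq]
    exact_mod_cast h
  have ht2 : (2 : ℝ) ^ t ≤ 2 * q := by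
    have h1 := Nat.pow_pred_clog_lt_self (b := 2) one_lt_two (x := j + 1) (by omega)
    have h2 : 0 < t := Nat.clog_pos one_lt_two (by omega)
    have h3 : 2 ^ t ≤ 2 * (j + 1) := by
      obtain ⟨u, hu⟩ := Nat.exists_eq_succ_of_ne_zero h2.ne'
      rw [← ht, hu, Nat.pred_succ] at h1
      rw [hu, Nat.succ_eq_add_one, pow_succ]
      omega
    rw [hq]
    exact_mod_cast h3
  have hd : (d : ℝ) ^ (4 * t * K) ≤ (2 * q) ^ (4 * d * K) := by
    calc (d : ℝ) ^ (4 * t * K) ≤ ((2 : ℝ) ^ d) ^ (4 * t * K) := by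
          gcongr
          exact_mod_cast (Nat.lt_two_pow_self (n := d)).le
      _ = ((2 : ℝ) ^ t) ^ (4 * d * K) := by rw [← pow_mul, ← pow_mul]; congr 1; ring
      _ ≤ (2 * q) ^ (4 * d * K) := by gcongr
  have hmain : A + (4 * t : ℕ) * (c * (d : ℝ) ^ (N + 4 * t * K)) ≤ A' * q ^ e := by
    calc A + (4 * t : ℕ) * (c * (d : ℝ) ^ (N + 4 * t * K))
        ≤ A * q ^ e + 4 * q * (c * ((d : ℝ) ^ N * (2 * q) ^ (4 * d * K))) := by
          push_cast
          rw [pow_add]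
          gcongr
          exact le_mul_of_one_le_right hA (one_le_pow₀ hq1)
      _ = A' * q ^ e := by rw [hA', he, mul_pow, pow_add q]; ring
  refine le_trans ?_ hj
  calc _ ≤ A' * q ^ e * ((4 / 5) ^ j * q ^ 3) := by gcongr
    _ = _ := by rw [pow_succ (4 / 5 : ℝ) j, pow_add]; ring

theorem le_of_mul_pow_le_factorial {x y : ℝ} {j : ℕ} (hy : 1 ≤ y) (hj : j = ⌊Real.log y⌋₊) (hj1 : 1 ≤ j)
    (h : x * (Real.log y ^ j / (4 * y ^ 2)) ≤ j.factorial * (16 / ((j : ℝ) + 1) ^ 3)) :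
    x ≤ 576 * y / Real.log y ^ 2 := by
  have hy0 : 0 < y := by linarith
  set L := Real.log y with hL
  have hj1' : (1 : ℝ) ≤ j := by exact_mod_cast hj1
  have hjL : (j : ℝ) ≤ L := by rw [hj]; exact Nat.floor_le (Real.log_nonneg hy)
  have hLj : L ≤ j + 1 := by rw [hj]; exact (Nat.lt_floor_add_one L).le
  have hL0 : 0 < L := by linarith
  have he3 := Real.exp_one_lt_three.le
  have hexp : Real.exp (-(j : ℝ)) ≤ 3 / y := by
    calc Real.exp (-(j : ℝ)) ≤ Real.exp (1 - L) := Real.exp_le_exp.2 (by linarith)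
      _ = Real.exp 1 / y := by rw [Real.exp_sub, Real.exp_log hy0]
      _ ≤ 3 / y := by gcongr
  have hfac : (j.factorial : ℝ) ≤ 9 * ((j : ℝ) + 1) * L ^ j / y := by
    calc (j.factorial : ℝ) ≤ Real.exp 1 * j * (j / Real.exp 1) ^ j :=
          factorial_le_mul_div_exp_pow (by omega)
      _ = Real.exp 1 * j * (j ^ j * Real.exp (-(j : ℝ))) := by
          rw [div_pow, ← Real.exp_nat_mul, Real.exp_neg, mul_one]; rfl
      _ ≤ 3 * ((j : ℝ) + 1) * (L ^ j * (3 / y)) := by gcongr; linarith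
      _ = _ := by ring
  have h1 : x * (L ^ j / (4 * y ^ 2)) ≤ 576 * y / L ^ 2 * (L ^ j / (4 * y ^ 2)) := by
    calc x * (L ^ j / (4 * y ^ 2)) ≤ 9 * ((j : ℝ) + 1) * L ^ j / y * (16 / ((j : ℝ) + 1) ^ 3) := by
          refine h.trans ?_
          gcongr
      _ = 144 * L ^ j / y * (1 / ((j : ℝ) + 1) ^ 2) := by field_simp; ring
      _ ≤ 144 * L ^ j / y * (1 / L ^ 2) := by gcongr
      _ = _ := by field_simp; ring
  exact le_of_mul_le_mul_right h1 (by positivity)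

theorem Pf_le_of_unbounded
    (hGRH : ∀ (q : ℕ) [NeZero q] (χ : DirichletCharacter ℂ q) (s : ℂ),
      0 < s.re → s.re < 1 → DirichletCharacter.LFunction χ s = 0 → s.re = 1 / 2)
    {f g : ℤ[X]} {a b : ℤ} (hdeg : 2 ≤ f.natDegree)
    (hder : derivative f = g ^ 2 * (C a * X + C b)) (ha : a ≠ 0) (h0 : IsPreperiodicPt f 0)
    (hγ : ¬ IsPreperiodicPt f (-(b : ℚ) / (a : ℚ)))
    (hinf : ∀ B : ℕ, ∃ p : ℕ, B ≤ p ∧ p.Prime ∧ DynIrred (f.map (Int.castRingHom (ZMod p)))) :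
    ∀ᶠ Q : ℕ in Filter.atTop, (Pf f Q : ℝ) ≤ 576 * Q / (Real.log Q) ^ 2 := by
  have hl0 : f.leadingCoeff ≠ 0 := by
    rw [leadingCoeff_ne_zero]; rintro rfl; simp at hdeg
  have hnot_dvd : ∀ {z : ℤ} {p : ℕ}, z ≠ 0 → z.natAbs + 1 ≤ p → ¬ (p : ℤ) ∣ z := by
    intro z p hz hp h
    have := Nat.le_of_dvd (Int.natAbs_pos.2 hz) (Int.natCast_dvd.1 h)
    omega
  have heval : ∀ k, 1 ≤ k → (polyIter f k).eval 0 ≠ 0 := by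
    intro k hk
    obtain ⟨p, hpB, hp, hirr⟩ := hinf (f.leadingCoeff.natAbs + 1)
    exact eval_zero_polyIter_ne_zero_of_dynIrred hp hdeg (hnot_dvd hl0 hpB) hirr hk
  have horbit : {z : ℤ | ∃ k, 1 ≤ k ∧ z = (polyIter f k).eval 0}.Finite := by
    refine (Set.Finite.preimage (Int.cast_injective (α := ℚ)).injOn h0).subset ?_
    rintro _ ⟨k, hk, rfl⟩
    exact ⟨k, hk, by simp [aeval_def, eval₂_at_zero, coeff_zero_eq_eval_zero]⟩
  set M : ℤ := 2 * a * f.leadingCoeff * ∏ z ∈ horbit.toFinset, z with hMdef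
  have hM : M ≠ 0 := by
    refine mul_ne_zero (mul_ne_zero (mul_ne_zero two_ne_zero ha) hl0)
      (Finset.prod_ne_zero_iff.2 fun z hz => ?_)
    obtain ⟨k, hk, rfl⟩ := horbit.mem_toFinset.1 hz
    exact heval k hk
  have hM2 : (2 : ℤ) ∣ M := ⟨a * f.leadingCoeff * ∏ z ∈ horbit.toFinset, z, by rw [hMdef]; ring⟩
  have hMa : a ∣ M := ⟨2 * f.leadingCoeff * ∏ z ∈ horbit.toFinset, z, by rw [hMdef]; ring⟩
  have hMl : f.leadingCoeff ∣ M := ⟨2 * a * ∏ z ∈ horbit.toFinset, z, by rw [hMdef]; ring⟩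
  have hMo : ∀ k, 1 ≤ k → (polyIter f k).eval 0 ∣ M := fun k hk =>
    (Finset.dvd_prod_of_mem (fun z : ℤ => z) (horbit.mem_toFinset.2 ⟨k, hk, rfl⟩)).trans
      (dvd_mul_left _ _)
  have hE0 : ∀ n, 2 ≤ n → critValue f a b n ≠ 0 := by
    intro n hn hzero
    obtain ⟨p, hpB, hp, hirr⟩ := hinf (M.natAbs + 1)
    have hpM := hnot_dvd hM hpB
    have h := jacobiSym_critValue hdeg ha hder hp
      (fun h => hpM (h ▸ hM2)) (fun h => hpM (h.trans hMa)) (fun h => hpM (h.trans hMl)) hirr hn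
    rw [hzero, jacobiSym.zero_left hp.one_lt] at h
    norm_num at h
  have heven := even_natDegree_of_derivative_eq hdeg ha hder
  obtain ⟨K, N₀, hwin⟩ := exists_window hdeg heven ha hinf hγ hM
  choose! ι hι p hp hpM hpodd using hwin
  set N := N₀ + 2 with hN
  set ν : ℕ → ℕ := fun t => N + t * K + (ι (N + t * K) + 1) with hν
  have hιt : ∀ t, ι (N + t * K) < K := fun t => hι _ (by rw [hN, add_assoc]; exact Nat.le_add_right _ _)
  have hνmono : StrictMono ν := strictMono_nat_of_lt_succ fun t => by
    have := hιt t
    simp only [hν, add_mul, one_mul]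
    omega
  have hν2 : ∀ t, 2 ≤ ν t := fun t => by simp only [hν, hN]; omega
  have hνle : ∀ {t r : ℕ}, t < r → ν t ≤ N + r * K := fun {t r} htr => by
    have h1 := hιt t
    have h2 : (t + 1) * K ≤ r * K := Nat.mul_le_mul_right K htr
    rw [add_mul, one_mul] at h2
    simp only [hν]
    omega
  obtain ⟨B, hB1, hB⟩ := exists_abs_critValue_le hdeg b ha
  have hlogB : 0 ≤ Real.log B := Real.log_nonneg hB1
  have hfloor : Filter.Tendsto (fun Q : ℕ => ⌊Real.log (Q : ℝ)⌋₊) Filter.atTop Filter.atTop :=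
    tendsto_nat_floor_atTop.comp (Real.tendsto_log_atTop.comp tendsto_natCast_atTop_atTop)
  filter_upwards [hfloor.eventually (clog_error_eventually_le (Real.log 56) (Real.log B)
      (Real.log_nonneg (by norm_num)) hlogB f.natDegree N K),
    hfloor.eventually ((Filter.tendsto_sub_atTop_nat 1).eventually eventually_tsum_sieveWeight_le),
    hfloor.eventually_ge_atTop 1, Filter.eventually_ge_atTop (M.natAbs + 1)] with Q herr htsum hj1 hQM
  have hQ1 : 1 ≤ Q := by omega
  refine le_of_mul_pow_le_factorial (by exact_mod_cast hQ1) rfl hj1 ?_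
  obtain ⟨k, hk⟩ := Nat.exists_eq_add_of_le' hj1
  simp only [hk] at herr htsum ⊢
  rw [Nat.add_sub_cancel] at htsum
  set T := Nat.clog 2 (k + 1 + 1) with hT
  set s := (Finset.range (4 * T)).image ν with hs
  have hscard : s.card = 4 * T := by
    rw [hs, Finset.card_image_of_injective _ hνmono.injective, Finset.card_range]
  have hPfin : {p : ℕ | p.Prime ∧ Q ≤ p ∧ p ≤ 2 * Q ∧
      DynIrred (f.map (Int.castRingHom (ZMod p)))}.Finite :=
    (Set.finite_Icc Q (2 * Q)).subset fun p hp => ⟨hp.2.1, hp.2.2.1⟩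
  have hPlarge : ∀ p ∈ hPfin.toFinset, ¬ (p : ℤ) ∣ M := fun p hp =>
    hnot_dvd hM (hQM.trans (hPfin.mem_toFinset.1 hp).2.1)
  have hsieve := two_pow_card_mul_card_le hGRH s (critValue f a b) (by
      intro i hi
      obtain ⟨t, -, rfl⟩ := Finset.mem_image.1 hi
      exact hE0 _ (hν2 t)) (by
      intro i hi
      obtain ⟨t, -, rfl⟩ := Finset.mem_image.1 hi
      have hge : N₀ ≤ N + t * K := by rw [hN, add_assoc]; exact Nat.le_add_right _ _
      have hpp := hp _ hge
      have hpMt := hpM _ hge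
      refine ⟨_, hpp, fun h => hpMt (h ▸ hM2), hpodd _ hge, fun j hj hdvd => ?_⟩
      refine eq_of_dvd_critValue (fun h => hpMt (h.trans hMa)) (fun h => hpMt (h.trans hMl)) hpp
        (fun k hk h => hpMt (h.trans (hMo k hk))) hdvd ?_
      by_contra hnd
      have hodd := hpodd _ hge
      rw [padicValInt.eq_zero_of_not_dvd hnd] at hodd
      exact absurd hodd (by decide)) hQ1 (P := hPfin.toFinset)
      (fun p hp => ⟨(hPfin.mem_toFinset.1 hp).1, fun h => hPlarge p hp (h ▸ hM2),
        (hPfin.mem_toFinset.1 hp).2.1, (hPfin.mem_toFinset.1 hp).2.2.1⟩) (by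
      intro p hp i hi
      obtain ⟨t, -, rfl⟩ := Finset.mem_image.1 hi
      have hpM := hPlarge p hp
      exact jacobiSym_critValue hdeg ha hder (hPfin.mem_toFinset.1 hp).1 (fun h => hpM (h ▸ hM2))
        (fun h => hpM (h.trans hMa)) (fun h => hpM (h.trans hMl)) (hPfin.mem_toFinset.1 hp).2.2.2
        (hν2 t)) k
  rw [hscard, ← Set.ncard_eq_toFinset_card _ hPfin] at hsieve
  have hlog : Real.log (56 * ∏ i ∈ s, |(critValue f a b i : ℝ)|) ≤ Real.log 56 +
      (4 * T : ℕ) * (Real.log B * (f.natDegree : ℝ) ^ (N + 4 * T * K)) := by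
    have hpos : ∀ i ∈ s, |(critValue f a b i : ℝ)| ≠ 0 := by
      intro i hi
      obtain ⟨t, -, rfl⟩ := Finset.mem_image.1 hi
      exact abs_ne_zero.2 (by exact_mod_cast hE0 _ (hν2 t))
    rw [Real.log_mul (by norm_num) (Finset.prod_ne_zero_iff.2 hpos), Real.log_prod hpos]
    refine add_le_add_right ?_ _
    rw [← hscard, ← nsmul_eq_mul, hscard]
    refine (Finset.sum_le_card_nsmul _ _ _ fun i hi => ?_).trans_eq (by rw [hscard])
    refine (Real.log_le_log ((abs_nonneg _).lt_of_ne' (hpos i hi)) (hB i)).trans ?_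
    rw [Real.log_pow, mul_comm]
    obtain ⟨t, ht, rfl⟩ := Finset.mem_image.1 hi
    push_cast
    have hd1 : (1 : ℝ) ≤ f.natDegree := by exact_mod_cast (by omega : 1 ≤ f.natDegree)
    have := hνle (Finset.mem_range.1 ht)
    gcongr
  have hq : (((k + 1 : ℕ) : ℝ) + 1) ^ 4 ≤ 2 ^ (4 * T) := by
    have h := Nat.le_pow_clog one_lt_two (k + 1 + 1)
    rw [mul_comm, pow_mul]
    gcongr
    exact_mod_cast h
  change (Pf f Q : ℝ) * _ ≤ _
  change 2 ^ (4 * T) * ((Pf f Q : ℝ) * _) ≤ _ at hsieve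
  set q : ℝ := ((k + 1 : ℕ) : ℝ) + 1 with hqdef
  have hq0 : 0 < q := by positivity
  set Ψ := Real.log 56 + (4 * T : ℕ) * (Real.log B * (f.natDegree : ℝ) ^ (N + 4 * T * K)) with hΨ
  set Y := (Pf f Q : ℝ) * (Real.log Q ^ (k + 1) / (4 * (Q : ℝ) ^ 2)) with hY
  set R : ℝ := 2 ^ (4 * T) with hR
  have hR0 : 0 < R := by positivity
  have h1 : Ψ * (4 / 5) ^ (k + 1) ≤ 1 / q ^ 3 := by
    rw [le_div_iff₀ (by positivity), mul_assoc]
    exact herr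
  have h2 : R * Y ≤ R * ((k + 1).factorial * (16 / q ^ 3)) := by
    calc R * Y ≤ 6 * ((k : ℝ) + 2) * (k + 1).factorial + R * ((k + 1).factorial *
          (10 * Ψ) / (5 / 4) ^ (k + 1)) := by
          refine hsieve.trans (add_le_add htsum ?_)
          gcongr
      _ = (k + 1).factorial * (6 * (q ^ 4 / q ^ 3) + R * (10 * (Ψ * (4 / 5) ^ (k + 1)))) := by
          rw [show (4 / 5 : ℝ) = (5 / 4)⁻¹ by norm_num, inv_pow,
            show q ^ 4 / q ^ 3 = (k : ℝ) + 2 by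
              rw [pow_succ q 3, mul_div_cancel_left₀ _ (by positivity), hqdef]; push_cast; ring]
          ring
      _ ≤ (k + 1).factorial * (6 * (R / q ^ 3) + R * (10 * (1 / q ^ 3))) := by gcongr
      _ = R * ((k + 1).factorial * (16 / q ^ 3)) := by ring
  exact le_of_mul_le_mul_left h2 hR0

end Frequency

theorem frequency_P3_GRH
    (hGRH : ∀ (q : ℕ) [NeZero q] (χ : DirichletCharacter ℂ q) (s : ℂ),
      0 < s.re → s.re < 1 → DirichletCharacter.LFunction χ s = 0 → s.re = 1 / 2)
    (f g : ℤ[X]) (a b : ℤ)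
    (hdeg : 2 ≤ f.natDegree)
    (hder : derivative f = g ^ 2 * (C a * X + C b))
    (ha : a ≠ 0)
    (h0 : IsPreperiodicPt f 0)
    (hγ : ¬ IsPreperiodicPt f (-(b : ℚ) / (a : ℚ))) :
    ∃ C : ℝ, 0 < C ∧ ∃ Q₀ : ℕ, ∀ Q : ℕ, Q₀ ≤ Q →
      (Pf f Q : ℝ) ≤ C * Q / (Real.log Q) ^ 2 := by
  refine ⟨576, by norm_num, ?_⟩
  by_cases hinf : ∀ B : ℕ, ∃ p : ℕ, B ≤ p ∧ p.Prime ∧ DynIrred (f.map (Int.castRingHom (ZMod p)))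
  · exact Filter.eventually_atTop.1 (Pf_le_of_unbounded hGRH hdeg hder ha h0 hγ hinf)
  · push Not at hinf
    obtain ⟨B, hB⟩ := hinf
    refine ⟨B, fun Q hQ => ?_⟩
    have : Pf f Q = 0 := by
      rw [Pf, Set.ncard_eq_zero ((Set.finite_Icc Q (2 * Q)).subset fun p hp => ⟨hp.2.1, hp.2.2.1⟩)]
      exact Set.eq_empty_of_forall_notMem fun p hp => hB p (hQ.trans hp.2.1) hp.1 hp.2.2.2
    rw [this, Nat.cast_zero]
    positivity
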